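/- Suppose λ_m(A) > 0 (equivalently β₁^m < β₂^m). Then there exist a γ-invariant set Θ₀ ⊆ Θ of full m-measure and measurable functions α_u, α_s : Θ₀ → [0,1/2), all independent of β, such that for every β with β₁^m < β < β₂^m and every θ ∈ Θ₀: there is c_β(θ) > 0 with 𝒜_β(θ) = {r·v(α_u(θ)) : |r| ≤ c_β(θ)} (a line segment of positive length), and the two-point set Ψ_β(θ) = {+c_β(θ)·v(α_u(θ)), −c_β(θ)·v(α_u(θ))} is a random forward attractor: lim_{n→∞} dist(f^n_{β,θ}(v), Ψ_β(γ^n θ)) = 0 for every v ∈ ℝ² not lying on the line ℝ·v(α_s(θ)). -/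

import Mathlib

open Filter MeasureTheory Metric Set
open scoped Topology

noncomputable section

/-- ℝ² with the Euclidean norm. -/
abbrev R2 : Type := EuclideanSpace ℝ (Fin 2)

/-- Action of a 2×2 real matrix on Euclidean ℝ². -/
def mulVecE (M : Matrix (Fin 2) (Fin 2) ℝ) (v : R2) : R2 :=
  (WithLp.equiv 2 (Fin 2 → ℝ)).symm (M.mulVec ((WithLp.equiv 2 (Fin 2 → ℝ)) v))

/-- Operator norm of a 2×2 real matrix induced by the Euclidean norm on ℝ². -/
def opNorm (M : Matrix (Fin 2) (Fin 2) ℝ) : ℝ :=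
  ‖(Matrix.toEuclideanCLM (𝕜 := ℝ) M : R2 →L[ℝ] R2)‖

/-- The cocycle `A_n(θ) = A(γ^{n-1}θ) ⋯ A(θ)`. -/
def coc {Θ : Type*} (γ : Θ → Θ) (A : Θ → Matrix (Fin 2) (Fin 2) ℝ) :
    ℕ → Θ → Matrix (Fin 2) (Fin 2) ℝ
  | 0, _ => 1
  | n + 1, θ => coc γ A n (γ θ) * A θ

/-- Maximal Lyapunov exponent `λ_max(A) = sup_θ limsup (1/n) log‖A_n(θ)‖`. -/
def lyapMax {Θ : Type*} (γ : Θ → Θ) (A : Θ → Matrix (Fin 2) (Fin 2) ℝ) : ℝ :=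
  ⨆ θ : Θ, Filter.limsup (fun n : ℕ => Real.log (opNorm (coc γ A n θ)) / n) Filter.atTop

/-- The hypotheses on `h`: C² on [0,∞), strictly increasing, strictly concave, bounded,
nonnegative, `h 0 = 0`, `h' 0 = 1`. -/
def GoodH (h : ℝ → ℝ) : Prop :=
  ContDiffOn ℝ 2 h (Set.Ici 0) ∧ StrictMonoOn h (Set.Ici 0) ∧
    StrictConcaveOn ℝ (Set.Ici 0) h ∧ BddAbove (h '' Set.Ici 0) ∧
    (∀ x ∈ Set.Ici (0 : ℝ), 0 ≤ h x) ∧ h 0 = 0 ∧ derivWithin h (Set.Ici 0) 0 = 1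

/-- The scaling condition `sup_{x ≥ 0} h(x) ≤ (sup_θ ‖A(θ)‖)⁻¹`. -/
def Scaled {Θ : Type*} (A : Θ → Matrix (Fin 2) (Fin 2) ℝ) (h : ℝ → ℝ) : Prop :=
  ∀ x ∈ Set.Ici (0 : ℝ), h x ≤ (⨆ θ : Θ, opNorm (A θ))⁻¹

open scoped Classical in
/-- The fibre maps `f_{β,θ}(v) = h(β‖v‖)·A(θ)·v/‖v‖`, `f_{β,θ}(0) = 0`. -/
def fibMap {Θ : Type*} (A : Θ → Matrix (Fin 2) (Fin 2) ℝ) (h : ℝ → ℝ) (β : ℝ)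
    (θ : Θ) (v : R2) : R2 :=
  if v = 0 then 0 else (h (β * ‖v‖) / ‖v‖) • mulVecE (A θ) v

/-- The skew product `f_β(θ,v) = (γθ, f_{β,θ}(v))`. -/
def skewProd {Θ : Type*} (γ : Θ → Θ) (A : Θ → Matrix (Fin 2) (Fin 2) ℝ) (h : ℝ → ℝ)
    (β : ℝ) : Θ × R2 → Θ × R2 :=
  fun p => (γ p.1, fibMap A h β p.1 p.2)

/-- The global attractor `𝒜_β = ⋂_{n∈ℕ} f_β^n(Θ × B̄₁(0))`. -/
def globalAttractor {Θ : Type*} (γ : Θ → Θ) (A : Θ → Matrix (Fin 2) (Fin 2) ℝ)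
    (h : ℝ → ℝ) (β : ℝ) : Set (Θ × R2) :=
  ⋂ n : ℕ, (skewProd γ A h β)^[n] '' (Set.univ ×ˢ Metric.closedBall (0 : R2) 1)

/-- The fibre `𝒜_β(θ) = {x : (θ,x) ∈ 𝒜_β}` of the global attractor. -/
def attractorFib {Θ : Type*} (γ : Θ → Θ) (A : Θ → Matrix (Fin 2) (Fin 2) ℝ)
    (h : ℝ → ℝ) (β : ℝ) (θ : Θ) : Set R2 :=
  {x : R2 | (θ, x) ∈ globalAttractor γ A h β}

/-- `v(α) = (cos 2πα, sin 2πα)ᵗ`. -/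
def vFull (α : ℝ) : R2 :=
  (WithLp.equiv 2 (Fin 2 → ℝ)).symm ![Real.cos (2 * Real.pi * α), Real.sin (2 * Real.pi * α)]

/-- `(cos πα, sin πα)ᵗ`, representing the projective point `α ∈ 𝕋 ≅ ℝP¹`. -/
def vHalf (α : ℝ) : R2 :=
  (WithLp.equiv 2 (Fin 2 → ℝ)).symm ![Real.cos (Real.pi * α), Real.sin (Real.pi * α)]

/-- The projective angle coordinate `p(w) = (1/π)·arg(w) mod 1 ∈ [0,1)` of a nonzero
vector `w ∈ ℝ²`; for `w ≠ 0` this equals `(1/π)·arctan(w₂/w₁) mod 1`. -/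
def projAngle (w : R2) : ℝ :=
  Int.fract (Complex.arg (Complex.ofReal (w 0) + Complex.ofReal (w 1) * Complex.I) / Real.pi)

/-- The projective action `g(θ,α) = (γθ, g_θ(α))` of the cocycle on `Θ × 𝕋`,
where `𝕋` is modelled by the fundamental domain `[0,1) ⊆ ℝ`. -/
def gMap {Θ : Type*} (γ : Θ → Θ) (A : Θ → Matrix (Fin 2) (Fin 2) ℝ) :
    Θ × ℝ → Θ × ℝ :=
  fun p => (γ p.1, projAngle (mulVecE (A p.1) (vHalf p.2)))

/-- `Ω(θ,α) = ‖A(θ)(cos πα, sin πα)ᵗ‖`. -/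
def Omega {Θ : Type*} (A : Θ → Matrix (Fin 2) (Fin 2) ℝ) (p : Θ × ℝ) : ℝ :=
  ‖mulVecE (A p.1) (vHalf p.2)‖

/-- The fibre maps `F_{β,θ,α}(r) = h(βr)·Ω(θ,α)` of the double skew product. -/
def dsFib {Θ : Type*} (A : Θ → Matrix (Fin 2) (Fin 2) ℝ) (h : ℝ → ℝ) (β : ℝ)
    (p : Θ × ℝ) (r : ℝ) : ℝ :=
  h (β * r) * Omega A p

/-- The double skew product `F_β(θ,α,r) = (g(θ,α), h(βr)·Ω(θ,α))` on `Θ × 𝕋 × [0,∞)`. -/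
def dsMap {Θ : Type*} (γ : Θ → Θ) (A : Θ → Matrix (Fin 2) (Fin 2) ℝ) (h : ℝ → ℝ)
    (β : ℝ) : Θ × ℝ × ℝ → Θ × ℝ × ℝ :=
  fun p => ((gMap γ A (p.1, p.2.1)).1, (gMap γ A (p.1, p.2.1)).2, dsFib A h β (p.1, p.2.1) p.2.2)

/-- `Ω_n(θ,α) = ∏_{i=0}^{n-1} Ω(g^i(θ,α))`. -/
def OmegaProd {Θ : Type*} (γ : Θ → Θ) (A : Θ → Matrix (Fin 2) (Fin 2) ℝ) (n : ℕ)
    (p : Θ × ℝ) : ℝ :=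
  ∏ i ∈ Finset.range n, Omega A ((gMap γ A)^[i] p)

/-- `Γ(a,b) = inf_{a ≤ x ≤ 1} inf_{0 < q ≤ b} h(qx)/(q·h(x))`. -/
def GammaH (h : ℝ → ℝ) (a b : ℝ) : ℝ :=
  sInf {y : ℝ | ∃ x ∈ Set.Icc a 1, ∃ q ∈ Set.Ioc (0 : ℝ) b, y = h (q * x) / (q * h x)}

/-- The inverse `g⁻¹(θ,α) = (γ⁻¹θ, projective angle of A(γ⁻¹θ)⁻¹·v(α))` of the
projective action. -/
def gInv {Θ : Type*} (γinv : Θ → Θ) (A : Θ → Matrix (Fin 2) (Fin 2) ℝ) :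
    Θ × ℝ → Θ × ℝ :=
  fun p => (γinv p.1, projAngle (mulVecE (A (γinv p.1))⁻¹ (vHalf p.2)))

/-- `F^n_{β,g^{-n}(θ,α)}(1)`, the pullback iterate defining the upper bounding graph. -/
def pullback1 {Θ : Type*} (γ : Θ → Θ) (γinv : Θ → Θ) (A : Θ → Matrix (Fin 2) (Fin 2) ℝ)
    (h : ℝ → ℝ) (β : ℝ) (n : ℕ) (p : Θ × ℝ) : ℝ :=
  ((dsMap γ A h β)^[n] (((gInv γinv A)^[n] p).1, ((gInv γinv A)^[n] p).2, 1)).2.2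

lemma mulVecE_eq_toEuclideanCLM (M : Matrix (Fin 2) (Fin 2) ℝ) (v : R2) :
    mulVecE M v = (Matrix.toEuclideanCLM (𝕜 := ℝ) M : R2 →L[ℝ] R2) v := rfl

lemma mulVecE_apply_zero (M : Matrix (Fin 2) (Fin 2) ℝ) (v : R2) :
    mulVecE M v 0 = M 0 0 * v 0 + M 0 1 * v 1 := by
  simp [mulVecE]

lemma mulVecE_apply_one (M : Matrix (Fin 2) (Fin 2) ℝ) (v : R2) :
    mulVecE M v 1 = M 1 0 * v 0 + M 1 1 * v 1 := by
  simp [mulVecE]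

lemma mulVecE_mul (M N : Matrix (Fin 2) (Fin 2) ℝ) (v : R2) :
    mulVecE (M * N) v = mulVecE M (mulVecE N v) := by
  rw [mulVecE, ← Matrix.mulVec_mulVec]
  rfl

lemma mulVecE_one (v : R2) : mulVecE 1 v = v := by
  simp [mulVecE]

lemma mulVecE_smul (M : Matrix (Fin 2) (Fin 2) ℝ) (c : ℝ) (v : R2) :
    mulVecE M (c • v) = c • mulVecE M v := by
  simp [mulVecE_eq_toEuclideanCLM]

lemma mulVecE_sub (M : Matrix (Fin 2) (Fin 2) ℝ) (v w : R2) :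
    mulVecE M (v - w) = mulVecE M v - mulVecE M w := by
  simp [mulVecE_eq_toEuclideanCLM]

lemma norm_mulVecE_le (M : Matrix (Fin 2) (Fin 2) ℝ) (v : R2) :
    ‖mulVecE M v‖ ≤ opNorm M * ‖v‖ :=
  (Matrix.toEuclideanCLM (𝕜 := ℝ) M : R2 →L[ℝ] R2).le_opNorm v

lemma opNorm_nonneg (M : Matrix (Fin 2) (Fin 2) ℝ) : 0 ≤ opNorm M := norm_nonneg _

lemma opNorm_mul_le (M N : Matrix (Fin 2) (Fin 2) ℝ) : opNorm (M * N) ≤ opNorm M * opNorm N := by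
  unfold opNorm
  rw [map_mul]
  exact norm_mul_le _ _

lemma norm_sq_R2 (v : R2) : ‖v‖ ^ 2 = v 0 ^ 2 + v 1 ^ 2 := by
  rw [EuclideanSpace.norm_sq_eq, Fin.sum_univ_two]
  simp

lemma ext_R2 {v w : R2} (h0 : v 0 = w 0) (h1 : v 1 = w 1) : v = w := by
  ext i
  fin_cases i
  · exact h0
  · exact h1

/-- The oriented area spanned by two plane vectors. -/
def wedge (v w : R2) : ℝ := v 0 * w 1 - v 1 * w 0

lemma wedge_mulVecE {M : Matrix (Fin 2) (Fin 2) ℝ} (hM : M.det = 1) (v w : R2) :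
    wedge (mulVecE M v) (mulVecE M w) = wedge v w := by
  rw [Matrix.det_fin_two] at hM
  simp only [wedge, mulVecE_apply_zero, mulVecE_apply_one]
  linear_combination (v 0 * w 1 - v 1 * w 0) * hM

lemma abs_wedge_le (v w : R2) : |wedge v w| ≤ ‖v‖ * ‖w‖ := by
  apply abs_le_of_sq_le_sq _ (by positivity)
  rw [mul_pow, norm_sq_R2, norm_sq_R2, wedge]
  nlinarith [sq_nonneg (v 0 * w 0 + v 1 * w 1)]

lemma wedge_smul_left (c : ℝ) (v w : R2) : wedge (c • v) w = c * wedge v w := by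
  simp [wedge]; ring

lemma wedge_smul_right (c : ℝ) (v w : R2) : wedge v (c • w) = c * wedge v w := by
  simp [wedge]; ring

lemma eq_smul_of_wedge_eq_zero {v w : R2} (hw : w ≠ 0) (h : wedge v w = 0) :
    ∃ t : ℝ, v = t • w := by
  have hw2 : ‖w‖ ^ 2 ≠ 0 := by simpa using hw
  refine ⟨(v 0 * w 0 + v 1 * w 1) / ‖w‖ ^ 2, ?_⟩
  rw [wedge] at h
  rw [norm_sq_R2] at *
  apply ext_R2
  · simp only [PiLp.smul_apply, smul_eq_mul]
    field_simp
    linear_combination (w 1) * h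
  · simp only [PiLp.smul_apply, smul_eq_mul]
    field_simp
    linear_combination (-w 0) * h

/-- Nearly parallel unit vectors are close to each other up to sign. -/
lemma exists_sign_norm_sub_le {v w : R2} (hv : ‖v‖ = 1) (hw : ‖w‖ = 1) :
    ∃ σ : ℝ, (σ = 1 ∨ σ = -1) ∧ ‖v - σ • w‖ ≤ 2 * |wedge v w| := by
  have hv2 := norm_sq_R2 v
  have hw2 := norm_sq_R2 w
  rw [hv] at hv2
  rw [hw] at hw2
  have key : (v 0 * w 0 + v 1 * w 1) ^ 2 + wedge v w ^ 2 = 1 := by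
    simp only [wedge]
    linear_combination (-(w 0 ^ 2 + w 1 ^ 2)) * hv2 - hw2
  have main : ∀ σ : ℝ, σ ^ 2 = 1 → 0 ≤ σ * (v 0 * w 0 + v 1 * w 1) →
      ‖v - σ • w‖ ≤ 2 * |wedge v w| := by
    intro σ hσ hs
    apply le_of_sq_le_sq _ (by positivity)
    rw [mul_pow, sq_abs, norm_sq_R2]
    simp only [PiLp.sub_apply, PiLp.smul_apply, smul_eq_mul]
    set s := σ * (v 0 * w 0 + v 1 * w 1) with hsdef
    have hs2 : s ^ 2 + wedge v w ^ 2 = 1 := by rw [hsdef, mul_pow, hσ]; linarith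
    have : (v 0 - σ * w 0) ^ 2 + (v 1 - σ * w 1) ^ 2 = 2 - 2 * s := by
      rw [hsdef]
      linear_combination -hv2 - hw2 + hσ * (w 0 ^ 2 + w 1 ^ 2)
    rw [this]
    have : s ≤ 1 := by nlinarith [sq_nonneg (wedge v w)]
    nlinarith
  rcases le_total 0 (v 0 * w 0 + v 1 * w 1) with h | h
  · exact ⟨1, Or.inl rfl, main 1 (by norm_num) (by simpa using h)⟩
  · exact ⟨-1, Or.inr rfl, main (-1) (by norm_num) (by linarith)⟩

lemma norm_le_opNorm_mul_norm_mulVecE {M : Matrix (Fin 2) (Fin 2) ℝ} (hM : M.det = 1) (v : R2) :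
    ‖v‖ ≤ opNorm M * ‖mulVecE M v‖ := by
  rcases eq_or_ne v 0 with rfl | hv
  · rw [norm_zero]; exact mul_nonneg (opNorm_nonneg _) (norm_nonneg _)
  set x : R2 := !₂[-v 1, v 0] with hx
  have hvpos : 0 < ‖v‖ := norm_pos_iff.mpr hv
  have hxn : ‖x‖ = ‖v‖ := by
    have : ‖x‖ ^ 2 = ‖v‖ ^ 2 := by
      rw [norm_sq_R2, norm_sq_R2]; simp [hx]; ring
    exact (sq_eq_sq₀ (norm_nonneg _) (norm_nonneg _)).mp this
  have h1 : wedge v x = ‖v‖ ^ 2 := by rw [norm_sq_R2]; simp [wedge, hx]; ring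
  have h2 := abs_wedge_le (mulVecE M v) (mulVecE M x)
  rw [wedge_mulVecE hM, h1, abs_of_nonneg (by positivity)] at h2
  have h3 := norm_mulVecE_le M x
  rw [hxn] at h3
  have : ‖v‖ * ‖v‖ ≤ (opNorm M * ‖mulVecE M v‖) * ‖v‖ := by
    nlinarith [norm_nonneg (mulVecE M v)]
  exact le_of_mul_le_mul_right this hvpos

lemma opNorm_inv_le {M : Matrix (Fin 2) (Fin 2) ℝ} (hM : M.det = 1) :
    opNorm M⁻¹ ≤ opNorm M := by
  refine ContinuousLinearMap.opNorm_le_bound _ (opNorm_nonneg _) fun v => ?_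
  have := norm_le_opNorm_mul_norm_mulVecE hM (mulVecE M⁻¹ v)
  rwa [← mulVecE_mul, Matrix.mul_nonsing_inv _ (by rw [hM]; exact isUnit_one), mulVecE_one] at this

lemma det_inv_eq_one {M : Matrix (Fin 2) (Fin 2) ℝ} (hM : M.det = 1) : M⁻¹.det = 1 := by
  rw [Matrix.det_nonsing_inv, hM, Ring.inverse_one]

lemma opNorm_inv {M : Matrix (Fin 2) (Fin 2) ℝ} (hM : M.det = 1) : opNorm M⁻¹ = opNorm M := by
  refine le_antisymm (opNorm_inv_le hM) ?_
  have := opNorm_inv_le (det_inv_eq_one hM)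
  rwa [Matrix.nonsing_inv_nonsing_inv _ (by rw [hM]; exact isUnit_one)] at this

lemma inv_apply_of_det_eq_one {M : Matrix (Fin 2) (Fin 2) ℝ} (hM : M.det = 1) :
    M⁻¹ = !![M 1 1, -M 0 1; -M 1 0, M 0 0] := by
  rw [Matrix.inv_def, hM, Matrix.adjugate_fin_two]; simp

/-- The squared Hilbert-Schmidt norm of a 2×2 matrix. -/
def hsSq (M : Matrix (Fin 2) (Fin 2) ℝ) : ℝ :=
  M 0 0 ^ 2 + M 0 1 ^ 2 + M 1 0 ^ 2 + M 1 1 ^ 2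

lemma two_le_hsSq {M : Matrix (Fin 2) (Fin 2) ℝ} (hM : M.det = 1) : 2 ≤ hsSq M := by
  rw [Matrix.det_fin_two] at hM
  unfold hsSq
  nlinarith [sq_nonneg (M 0 0 - M 1 1), sq_nonneg (M 0 1 + M 1 0)]

lemma opNorm_sq_le_hsSq (M : Matrix (Fin 2) (Fin 2) ℝ) : opNorm M ^ 2 ≤ hsSq M := by
  have h0 : 0 ≤ hsSq M := by unfold hsSq; positivity
  have : opNorm M ≤ √(hsSq M) := by
    refine ContinuousLinearMap.opNorm_le_bound _ (Real.sqrt_nonneg _) fun v => ?_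
    rw [← mulVecE_eq_toEuclideanCLM]
    apply le_of_sq_le_sq _ (by positivity)
    rw [mul_pow, Real.sq_sqrt h0, norm_sq_R2, norm_sq_R2, mulVecE_apply_zero, mulVecE_apply_one,
      hsSq]
    nlinarith [sq_nonneg (M 0 0 * v 1 - M 0 1 * v 0), sq_nonneg (M 1 0 * v 1 - M 1 1 * v 0)]
  calc opNorm M ^ 2 ≤ √(hsSq M) ^ 2 := pow_le_pow_left₀ (opNorm_nonneg _) this 2
    _ = _ := Real.sq_sqrt h0

lemma hsSq_le (M : Matrix (Fin 2) (Fin 2) ℝ) : hsSq M ≤ 2 * opNorm M ^ 2 := by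
  have h (v : R2) (hv : ‖v‖ ^ 2 = 1) : ‖mulVecE M v‖ ^ 2 ≤ opNorm M ^ 2 := by
    have := pow_le_pow_left₀ (norm_nonneg _) (norm_mulVecE_le M v) 2
    rwa [mul_pow, hv, mul_one] at this
  have h1 := h !₂[1, 0] (by rw [norm_sq_R2]; simp)
  have h2 := h !₂[0, 1] (by rw [norm_sq_R2]; simp)
  rw [norm_sq_R2, mulVecE_apply_zero, mulVecE_apply_one] at h1 h2
  simp at h1 h2
  unfold hsSq
  linarith

lemma one_le_opNorm {M : Matrix (Fin 2) (Fin 2) ℝ} (hM : M.det = 1) : 1 ≤ opNorm M := by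
  have := two_le_hsSq hM
  have := hsSq_le M
  nlinarith [opNorm_nonneg M]

lemma continuous_opNorm : Continuous fun f : Fin 2 → Fin 2 → ℝ => opNorm (Matrix.of f) := by
  let L : (Fin 2 → Fin 2 → ℝ) →ₗ[ℝ] (R2 →L[ℝ] R2) :=
    { toFun := fun f => (Matrix.toEuclideanCLM (𝕜 := ℝ) (Matrix.of f) : R2 →L[ℝ] R2)
      map_add' := fun f g => map_add (Matrix.toEuclideanCLM (n := Fin 2) (𝕜 := ℝ)) (Matrix.of f) (Matrix.of g)
      map_smul' := fun c f => map_smul (Matrix.toEuclideanCLM (n := Fin 2) (𝕜 := ℝ)) c (Matrix.of f) }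
  exact continuous_norm.comp (LinearMap.continuous_of_finiteDimensional L)

lemma measurable_opNorm {Θ : Type*} [MeasurableSpace Θ] {A : Θ → Matrix (Fin 2) (Fin 2) ℝ}
    (hA : ∀ i j, Measurable fun θ => A θ i j) : Measurable fun θ => opNorm (A θ) :=
  continuous_opNorm.measurable.comp
    (measurable_pi_lambda _ fun i => measurable_pi_lambda _ fun j => hA i j)

section Cocycle

variable {Θ : Type*} {γ : Θ → Θ} {A : Θ → Matrix (Fin 2) (Fin 2) ℝ}

lemma coc_add (n k : ℕ) (θ : Θ) : coc γ A (n + k) θ = coc γ A k (γ^[n] θ) * coc γ A n θ := by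
  induction n generalizing θ with
  | zero => simp [coc]
  | succ n ih =>
    rw [show n + 1 + k = (n + k) + 1 by ring]
    simp only [coc, ih, Function.iterate_succ_apply, mul_assoc]

lemma coc_one (θ : Θ) : coc γ A 1 θ = A θ := by simp [coc]

lemma coc_succ (n : ℕ) (θ : Θ) : coc γ A (n + 1) θ = A (γ^[n] θ) * coc γ A n θ := by
  rw [coc_add, coc_one]

lemma det_coc (hdet : ∀ θ, (A θ).det = 1) (n : ℕ) (θ : Θ) : (coc γ A n θ).det = 1 := by
  induction n generalizing θ with
  | zero => simp [coc]
  | succ n ih => simp [coc, ih, hdet]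

lemma opNorm_coc_le {C : ℝ} (hC : ∀ θ, opNorm (A θ) ≤ C) (n : ℕ) (θ : Θ) :
    opNorm (coc γ A n θ) ≤ C ^ n := by
  have hC0 : 0 ≤ C := (opNorm_nonneg _).trans (hC θ)
  induction n generalizing θ with
  | zero => simp [coc, opNorm]
  | succ n ih =>
    rw [coc, pow_succ]
    exact (opNorm_mul_le _ _).trans (mul_le_mul (ih _) (hC _) (opNorm_nonneg _) (by positivity))

lemma measurable_coc [MeasurableSpace Θ] (hγ : Measurable γ)
    (hA : ∀ i j, Measurable fun θ => A θ i j) (n : ℕ) (i j : Fin 2) :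
    Measurable fun θ => coc γ A n θ i j := by
  induction n generalizing i j with
  | zero => exact measurable_const
  | succ n ih =>
    simp only [coc, Matrix.mul_apply, Fin.sum_univ_two]
    exact (((ih i 0).comp hγ).mul (hA 0 j)).add (((ih i 1).comp hγ).mul (hA 1 j))

lemma mulVecE_coc_succ (n : ℕ) (θ : Θ) (v : R2) :
    mulVecE (coc γ A (n + 1) θ) v = mulVecE (coc γ A n (γ θ)) (mulVecE (A θ) v) := by
  rw [coc, mulVecE_mul]

lemma mulVecE_ne_zero {M : Matrix (Fin 2) (Fin 2) ℝ} (hM : M.det = 1) {v : R2} (hv : v ≠ 0) :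
    mulVecE M v ≠ 0 := by
  intro h
  have := norm_le_opNorm_mul_norm_mulVecE hM v
  rw [h, norm_zero, mul_zero] at this
  exact hv (norm_le_zero_iff.mp this)

end Cocycle

/-- The generator of the cocycle over the inverse base map. -/
def invGen {Θ : Type*} (γ : Θ ≃ Θ) (A : Θ → Matrix (Fin 2) (Fin 2) ℝ) (θ : Θ) :
    Matrix (Fin 2) (Fin 2) ℝ :=
  (A (γ.symm θ))⁻¹

lemma iterate_symm_apply {Θ : Type*} (γ : Θ ≃ Θ) (n : ℕ) (θ : Θ) :
    (⇑γ)^[n] ((⇑γ.symm)^[n] θ) = θ :=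
  (Function.LeftInverse.iterate γ.apply_symm_apply n) θ

lemma symm_iterate_apply {Θ : Type*} (γ : Θ ≃ Θ) (n : ℕ) (θ : Θ) :
    (⇑γ.symm)^[n] ((⇑γ)^[n] θ) = θ :=
  (Function.LeftInverse.iterate γ.symm_apply_apply n) θ

lemma coc_invGen {Θ : Type*} (γ : Θ ≃ Θ) (A : Θ → Matrix (Fin 2) (Fin 2) ℝ) (n : ℕ) (θ : Θ) :
    coc (⇑γ.symm) (invGen γ A) n θ = (coc (⇑γ) A n ((⇑γ.symm)^[n] θ))⁻¹ := by
  induction n generalizing θ with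
  | zero => simp [coc]
  | succ n ih =>
    rw [coc, ih, coc_succ, Matrix.mul_inv_rev, invGen, Function.iterate_succ_apply,
      iterate_symm_apply]

section Subadditive

variable {Θ : Type*} {γ : Θ → Θ} {g : ℕ → Θ → ℝ} {K : ℝ}

/-- Greedy covering bound for a subadditive process: orbit segments starting in `G` are covered by
blocks on which the process grows at rate at most `b`. -/
lemma subadditive_greedy_bound (h0 : ∀ n θ, 0 ≤ g n θ) (hK : ∀ n θ, g n θ ≤ n * K)
    (hsub : ∀ n k θ, g (n + k) θ ≤ g n θ + g k (γ^[n] θ)) {b : ℝ} (hb : 0 ≤ b) {G : Set Θ} {N : ℕ}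
    (hG : ∀ θ ∈ G, ∃ j : ℕ, 1 ≤ j ∧ j ≤ N ∧ g j θ ≤ b * j) (n : ℕ) (θ : Θ) :
    g n θ ≤ b * n + K * birkhoffSum γ (Gᶜ.indicator 1) n θ + K * N := by
  have hK0 : 0 ≤ K := by simpa using (h0 1 θ).trans (hK 1 θ)
  have hS (n : ℕ) (θ : Θ) : 0 ≤ birkhoffSum γ (Gᶜ.indicator (1 : Θ → ℝ)) n θ :=
    Finset.sum_nonneg fun i _ => indicator_nonneg (fun _ _ => zero_le_one) _
  induction n using Nat.strong_induction_on generalizing θ with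
  | _ n ih =>
  rcases le_or_gt n N with hn | hn
  · have h1 : (n : ℝ) * K ≤ K * N := by
      rw [mul_comm]; exact mul_le_mul_of_nonneg_left (by exact_mod_cast hn) hK0
    have h2 : 0 ≤ b * n := by positivity
    have h3 := mul_nonneg hK0 (hS n θ)
    linarith [hK n θ]
  by_cases hθ : θ ∈ G
  · obtain ⟨j, hj1, hjN, hj⟩ := hG θ hθ
    obtain ⟨k, rfl⟩ := Nat.exists_eq_add_of_le (hjN.trans hn.le)
    have h1 := ih k (by omega) (γ^[j] θ)
    have h2 := hsub j k θ
    rw [birkhoffSum_add]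
    push_cast
    nlinarith [mul_nonneg hK0 (hS j θ)]
  · obtain ⟨k, rfl⟩ := Nat.exists_eq_add_of_le (show 1 ≤ n by omega)
    have h1 := ih k (by omega) (γ^[1] θ)
    have h2 := hsub 1 k θ
    have h3 := hK 1 θ
    rw [birkhoffSum_add, birkhoffSum_one, indicator_of_mem (show θ ∈ Gᶜ from hθ)]
    push_cast at *
    simp only [Pi.one_apply]
    nlinarith

/-- Averaging over shifts: a subadditive process is bounded by Birkhoff sums of its `k`-th term. -/
lemma subadditive_le_birkhoffSum (h0 : ∀ n θ, 0 ≤ g n θ) (hK : ∀ n θ, g n θ ≤ n * K)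
    (hsub : ∀ n k θ, g (n + k) θ ≤ g n θ + g k (γ^[n] θ)) (k n : ℕ) (θ : Θ) :
    k * g (n + k) θ ≤ birkhoffSum γ (g k) n θ + 2 * k * (k * K) := by
  have hK0 : 0 ≤ K := by simpa using (h0 1 θ).trans (hK 1 θ)
  have hH (n : ℕ) : ∑ j ∈ Finset.range k, g (n + j) θ ≤
      birkhoffSum γ (g k) n θ + k * (k * K) := by
    induction n with
    | zero =>
      rw [birkhoffSum_zero, zero_add]
      calc ∑ j ∈ Finset.range k, g (0 + j) θ ≤ ∑ j ∈ Finset.range k, (k * K) := by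
            refine Finset.sum_le_sum fun j hj => ?_
            rw [zero_add]
            refine (hK j θ).trans (mul_le_mul_of_nonneg_right ?_ hK0)
            exact_mod_cast (Finset.mem_range.mp hj).le
        _ = _ := by simp
    | succ n ih =>
      have h1 := Finset.sum_range_succ (fun j => g (n + j) θ) k
      have h2 := Finset.sum_range_succ' (fun j => g (n + j) θ) k
      have h3 := hsub n k θ
      rw [birkhoffSum_succ]
      have h4 : ∑ j ∈ Finset.range k, g (n + 1 + j) θ = ∑ j ∈ Finset.range k, g (n + (j + 1)) θ :=
        Finset.sum_congr rfl fun j _ => by congr 1; ring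
      simp only [add_zero] at h2
      linarith
  have h5 : (k : ℝ) * g (n + k) θ ≤ ∑ j ∈ Finset.range k, g (n + j) θ + k * (k * K) := by
    have : ∑ j ∈ Finset.range k, g (n + k) θ ≤ ∑ j ∈ Finset.range k, (g (n + j) θ + k * K) := by
      refine Finset.sum_le_sum fun j hj => ?_
      have hj := Finset.mem_range.mp hj
      have h6 := hsub (n + j) (k - j) θ
      rw [show n + j + (k - j) = n + k by omega] at h6
      refine h6.trans (add_le_add_right ((hK _ _).trans (mul_le_mul_of_nonneg_right ?_ hK0)) _)
      exact_mod_cast Nat.sub_le k j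
    simpa [Finset.sum_add_distrib] using this
  linarith [hH n]

variable [MeasurableSpace Θ] {m : Measure Θ}

lemma integrable_birkhoffSum (hγ : MeasurePreserving γ m m) {φ : Θ → ℝ} (hφ : Integrable φ m)
    (n : ℕ) : Integrable (fun θ => birkhoffSum γ φ n θ) m :=
  integrable_finsetSum _ fun i _ => ((hγ.iterate i).integrable_comp hφ.1).mpr hφ

lemma integral_birkhoffSum (hγ : MeasurePreserving γ m m) {φ : Θ → ℝ} (hφ : Integrable φ m)
    (n : ℕ) : ∫ θ, birkhoffSum γ φ n θ ∂m = n * ∫ θ, φ θ ∂m := by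
  have h (i : ℕ) : ∫ θ, φ (γ^[i] θ) ∂m = ∫ θ, φ θ ∂m := by
    have hi := hγ.iterate i
    conv_rhs => rw [← hi.map_eq]
    rw [integral_map hi.measurable.aemeasurable (by rw [hi.map_eq]; exact hφ.1)]
  simp only [birkhoffSum]
  rw [integral_finsetSum (f := fun i θ => φ (γ^[i] θ)) _
    fun i _ => ((hγ.iterate i).integrable_comp hφ.1).mpr hφ]
  simp [h]

variable [IsProbabilityMeasure m]

lemma integrable_of_bounded {φ : Θ → ℝ} (hφ : Measurable φ) {C : ℝ} (h0 : ∀ θ, 0 ≤ φ θ)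
    (hC : ∀ θ, φ θ ≤ C) : Integrable φ m :=
  Integrable.of_bound hφ.aestronglyMeasurable C
    (ae_of_all _ fun θ => by rw [Real.norm_of_nonneg (h0 θ)]; exact hC θ)

/-- If almost every point frequently sees growth rate at most `b`, then the mean growth rate is at
most `b`. -/
lemma mean_rate_le_of_frequently (hγ : MeasurePreserving γ m m) (hmeas : ∀ n, Measurable (g n))
    (h0 : ∀ n θ, 0 ≤ g n θ) (hK : ∀ n θ, g n θ ≤ n * K)
    (hsub : ∀ n k θ, g (n + k) θ ≤ g n θ + g k (γ^[n] θ)) {lam : ℝ}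
    (hlam : Tendsto (fun n : ℕ => (∫ θ, g n θ ∂m) / n) atTop (𝓝 lam)) {b : ℝ} (hb : 0 ≤ b)
    (hfreq : ∀ᵐ θ ∂m, ∃ n : ℕ, 1 ≤ n ∧ g n θ ≤ b * n) : lam ≤ b := by
  obtain ⟨θ₀⟩ : Nonempty Θ := nonempty_of_isProbabilityMeasure m
  have hK0 : 0 ≤ K := by simpa using (h0 1 θ₀).trans (hK 1 θ₀)
  let G : ℕ → Set Θ := fun N => {θ | ∃ j : ℕ, 1 ≤ j ∧ j ≤ N ∧ g j θ ≤ b * j}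
  have hGm (N : ℕ) : MeasurableSet (G N) := by
    have : G N = ⋃ j : ℕ, {θ | 1 ≤ j ∧ j ≤ N ∧ g j θ ≤ b * j} := by ext; simp [G]
    rw [this]
    refine MeasurableSet.iUnion fun j => ?_
    exact (MeasurableSet.const _).inter
      ((MeasurableSet.const _).inter (measurableSet_le (hmeas j) measurable_const))
  have hGmono : Monotone G := fun N N' hN θ ⟨j, h1, h2, h3⟩ => ⟨j, h1, h2.trans hN, h3⟩
  have hstep (N : ℕ) : lam ≤ b + K * m.real (G N)ᶜ := by
    have hint : Integrable ((G N)ᶜ.indicator (1 : Θ → ℝ)) m :=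
      (integrable_const (1 : ℝ)).indicator (hGm N).compl
    have hub (n : ℕ) : ∫ θ, g n θ ∂m ≤ b * n + K * (n * m.real (G N)ᶜ) + K * N := by
      have h1 : ∫ θ, g n θ ∂m ≤
          ∫ θ, (b * n + K * birkhoffSum γ ((G N)ᶜ.indicator 1) n θ + K * N) ∂m := by
        refine integral_mono (integrable_of_bounded (hmeas n) (h0 n) (hK n)) ?_
          (subadditive_greedy_bound h0 hK hsub hb (G := G N) (fun θ hθ => hθ) n)
        exact ((integrable_const _).add ((integrable_birkhoffSum hγ hint n).const_mul K)).add
          (integrable_const _)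
      refine h1.trans_eq ?_
      have hi := (integrable_birkhoffSum hγ hint n).const_mul K
      rw [integral_add (f := fun θ => b * n + K * birkhoffSum γ ((G N)ᶜ.indicator 1) n θ)
          ((integrable_const _).add hi) (integrable_const _),
        integral_add (integrable_const _) hi, integral_const_mul K,
        integral_birkhoffSum hγ hint, integral_indicator_one (hGm N).compl]
      simp
    have hlim : Tendsto (fun n : ℕ => b + K * m.real (G N)ᶜ + K * N / (n : ℝ)) atTop
        (𝓝 (b + K * m.real (G N)ᶜ + 0)) :=
      tendsto_const_nhds.add (tendsto_const_div_atTop_nhds_zero_nat _)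
    rw [add_zero] at hlim
    refine le_of_tendsto_of_tendsto hlam hlim ?_
    filter_upwards [eventually_gt_atTop 0] with n hn
    have hn' : (0 : ℝ) < n := by exact_mod_cast hn
    rw [div_le_iff₀ hn']
    have := hub n
    field_simp
    linarith
  have hlim : Tendsto (fun N => b + K * m.real (G N)ᶜ) atTop (𝓝 (b + K * 0)) := by
    refine tendsto_const_nhds.add (Tendsto.const_mul K ?_)
    have h1 : Tendsto (fun N => m (G N)ᶜ) atTop (𝓝 (m (⋂ N, (G N)ᶜ))) :=
      tendsto_measure_iInter_atTop (fun N => (hGm N).compl.nullMeasurableSet)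
        (fun N N' hN => compl_subset_compl.mpr (hGmono hN)) ⟨0, measure_ne_top _ _⟩
    have h2 : m (⋂ N, (G N)ᶜ) = 0 := by
      refine measure_mono_null ?_ hfreq
      intro θ hθ hcon
      obtain ⟨n, hn1, hn2⟩ := hcon
      exact (mem_iInter.mp hθ n) ⟨n, hn1, le_rfl, hn2⟩
    rw [h2] at h1
    exact (ENNReal.tendsto_toReal ENNReal.zero_ne_top).comp h1
  rw [mul_zero, add_zero] at hlim
  exact ge_of_tendsto' hlim hstep

/-- Lower half of the subadditive ergodic theorem for bounded processes. -/
lemma eventually_ge_of_lt_mean_rate (hγ : Ergodic γ m) (hmeas : ∀ n, Measurable (g n))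
    (h0 : ∀ n θ, 0 ≤ g n θ) (hK : ∀ n θ, g n θ ≤ n * K)
    (hsub : ∀ n k θ, g (n + k) θ ≤ g n θ + g k (γ^[n] θ)) {lam : ℝ}
    (hlam : Tendsto (fun n : ℕ => (∫ θ, g n θ ∂m) / n) atTop (𝓝 lam)) {b : ℝ} (hb : b < lam) :
    ∀ᵐ θ ∂m, ∀ᶠ n : ℕ in atTop, b * n ≤ g n θ := by
  have main (b : ℝ) (hb : b < lam) :
      m {θ | ∃ a : ℚ, (a : ℝ) < b ∧ ∃ᶠ n : ℕ in atTop, g n θ ≤ a * n} = 0 := by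
    set L : Set Θ := {θ | ∃ a : ℚ, (a : ℝ) < b ∧ ∃ᶠ n : ℕ in atTop, g n θ ≤ a * n} with hL
    have hLm : MeasurableSet L := by
      have : L = ⋃ a : ℚ, {θ | (a : ℝ) < b} ∩ ⋂ N : ℕ, ⋃ n : ℕ, {θ | N ≤ n ∧ g n θ ≤ a * n} := by
        ext θ; simp [hL, frequently_atTop]
      rw [this]
      refine MeasurableSet.iUnion fun a => (MeasurableSet.const _).inter
        (MeasurableSet.iInter fun N => MeasurableSet.iUnion fun n => ?_)
      exact (MeasurableSet.const _).inter (measurableSet_le (hmeas n) measurable_const)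
    have hsubset : γ ⁻¹' L ⊆ L := by
      rintro θ ⟨a, hab, ha⟩
      obtain ⟨a', haa', ha'b⟩ := exists_rat_btwn hab
      have haa'' : a < a' := by exact_mod_cast haa'
      refine ⟨a', ha'b, ?_⟩
      have hpos : (0 : ℝ) < a' - a := by linarith
      obtain ⟨N, hN⟩ := exists_nat_gt ((K - a') / (a' - a))
      have hev : ∀ᶠ n : ℕ in atTop, N ≤ n := eventually_ge_atTop N
      have := (ha.and_eventually hev)
      rw [frequently_atTop] at this ⊢
      intro M
      obtain ⟨n, hnM, hn, hnN⟩ := this M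
      refine ⟨1 + n, by omega, ?_⟩
      have h1 := hsub 1 n θ
      have h2 := hK 1 θ
      simp only [Function.iterate_one] at h1
      push_cast at h2 ⊢
      have h3 : (K - a') / (a' - a) < n := hN.trans_le (by exact_mod_cast hnN)
      rw [div_lt_iff₀ hpos] at h3
      nlinarith
    rcases hγ.ae_empty_or_univ_of_preimage_ae_le hLm.nullMeasurableSet
      hsubset.eventuallyLE with h | h
    · rwa [ae_eq_empty] at h
    · exfalso
      obtain ⟨θ₀, hθ₀⟩ : ∃ θ, θ ∈ L := by
        have : ∀ᵐ θ ∂m, θ ∈ L := by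
          filter_upwards [h] with θ hθ
          exact (eq_iff_iff.mp hθ).mpr trivial
        exact this.exists
      have hb0 : 0 ≤ b := by
        obtain ⟨a, hab, ha⟩ := hθ₀
        obtain ⟨n, hn, hn1⟩ := (ha.and_eventually (eventually_ge_atTop 1)).exists
        have hn' : (1 : ℝ) ≤ n := by exact_mod_cast hn1
        have := h0 n θ₀
        have : (0 : ℝ) ≤ a := by
          by_contra hneg
          push Not at hneg
          nlinarith
        linarith
      refine absurd (mean_rate_le_of_frequently hγ.toMeasurePreserving hmeas h0 hK hsub hlam hb0 ?_)
        (not_le.mpr hb)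
      filter_upwards [h] with θ hθ
      obtain ⟨a, hab, ha⟩ := (eq_iff_iff.mp hθ).mpr trivial
      obtain ⟨n, hn, hn1⟩ := (ha.and_eventually (eventually_ge_atTop 1)).exists
      exact ⟨n, hn1, hn.trans (mul_le_mul_of_nonneg_right hab.le (by positivity))⟩
  obtain ⟨a, hba, hal⟩ := exists_rat_btwn hb
  obtain ⟨b', hab', hb'l⟩ := exists_between hal
  have h := measure_eq_zero_iff_ae_notMem.mp (main b' hb'l)
  filter_upwards [h] with θ hθ
  have h1 : ¬ ∃ᶠ n : ℕ in atTop, g n θ ≤ a * n := fun hf => hθ ⟨a, hab', hf⟩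
  rw [not_frequently] at h1
  filter_upwards [h1] with n hn
  push Not at hn
  exact (mul_le_mul_of_nonneg_right hba.le (by positivity)).trans hn.le

/-- Upper half of the subadditive ergodic theorem for bounded processes. -/
lemma eventually_le_of_mean_rate_lt (hγ : Ergodic γ m) (hmeas : ∀ n, Measurable (g n))
    (h0 : ∀ n θ, 0 ≤ g n θ) (hK : ∀ n θ, g n θ ≤ n * K)
    (hsub : ∀ n k θ, g (n + k) θ ≤ g n θ + g k (γ^[n] θ)) {lam : ℝ}
    (hlam : Tendsto (fun n : ℕ => (∫ θ, g n θ ∂m) / n) atTop (𝓝 lam)) {b : ℝ} (hb : lam < b) :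
    ∀ᵐ θ ∂m, ∀ᶠ n : ℕ in atTop, g n θ ≤ b * n := by
  obtain ⟨θ₀⟩ : Nonempty Θ := nonempty_of_isProbabilityMeasure m
  have hK0 : 0 ≤ K := by simpa using (h0 1 θ₀).trans (hK 1 θ₀)
  obtain ⟨b', hlb', hb'b⟩ := exists_between hb
  obtain ⟨k, hk, hk1⟩ := ((hlam.eventually_lt_const hlb').and (eventually_ge_atTop 1)).exists
  have hk0 : (0 : ℝ) < k := by exact_mod_cast hk1
  rw [div_lt_iff₀ hk0] at hk
  set φ : Θ → ℝ := fun θ => k * K - g k θ with hφ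
  have hφm : Measurable φ := measurable_const.sub (hmeas k)
  have hφ0 (θ : Θ) : 0 ≤ φ θ := sub_nonneg.mpr (hK k θ)
  have hφK (θ : Θ) : φ θ ≤ k * K := by simp only [hφ]; linarith [h0 k θ]
  have hφi : Integrable φ m := integrable_of_bounded hφm hφ0 hφK
  have hlim : Tendsto (fun n : ℕ => (∫ θ, birkhoffSum γ φ n θ ∂m) / n) atTop
      (𝓝 (∫ θ, φ θ ∂m)) := by
    refine tendsto_const_nhds.congr' ?_
    filter_upwards [eventually_gt_atTop 0] with n hn
    have : (n : ℝ) ≠ 0 := by positivity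
    rw [integral_birkhoffSum hγ.toMeasurePreserving hφi]
    field_simp
  have hφint : k * K - b' * k < ∫ θ, φ θ ∂m := by
    simp only [hφ]
    rw [integral_sub (integrable_const _) (integrable_of_bounded (hmeas k) (h0 k) (hK k))]
    simp
    linarith
  have := eventually_ge_of_lt_mean_rate hγ (g := fun n θ => birkhoffSum γ φ n θ) (K := k * K)
    (fun n => Finset.measurable_sum _ fun i _ => hφm.comp (hγ.measurable.iterate i))
    (fun n θ => Finset.sum_nonneg fun i _ => hφ0 _)
    (fun n θ => (Finset.sum_le_sum fun i _ => hφK _).trans_eq (by simp))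
    (fun n j θ => (birkhoffSum_add γ φ n j θ).le) hlim hφint
  filter_upwards [this] with θ hθ
  have hpos : 0 < b - b' := sub_pos.mpr hb'b
  obtain ⟨N, hN⟩ := exists_nat_gt ((2 * (k * K) - b * k) / (b - b'))
  have hev : ∀ᶠ n : ℕ in atTop, g (n + k) θ ≤ b * (n + k : ℕ) := by
    filter_upwards [hθ, eventually_ge_atTop N] with n hn hnN
    have h1 := subadditive_le_birkhoffSum h0 hK hsub k n θ
    have h2 : birkhoffSum γ φ n θ = n * (k * K) - birkhoffSum γ (g k) n θ := by
      simp [hφ, birkhoffSum, Finset.sum_sub_distrib]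
    rw [h2] at hn
    have h3 : (2 * (k * K) - b * k) / (b - b') < n := hN.trans_le (by exact_mod_cast hnN)
    rw [div_lt_iff₀ hpos] at h3
    push_cast
    have h4 : (k : ℝ) * g (n + k) θ ≤ k * (b * (n + k)) := by
      have h5 := mul_le_mul_of_nonneg_left h3.le hk0.le
      nlinarith
    exact le_of_mul_le_mul_left h4 hk0
  rw [← map_add_atTop_eq_nat k]
  exact hev

end Subadditive

/-- The contracted direction of a matrix, as a point of the closed unit disc in doubled-angle
coordinates. -/
def contractDir (M : Matrix (Fin 2) (Fin 2) ℝ) : ℂ :=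
  ⟨((M 0 1 ^ 2 + M 1 1 ^ 2) - (M 0 0 ^ 2 + M 1 0 ^ 2)) / hsSq M,
    -(2 * (M 0 0 * M 0 1 + M 1 0 * M 1 1)) / hsSq M⟩

lemma normSq_contractDir {M : Matrix (Fin 2) (Fin 2) ℝ} (hM : M.det = 1) :
    ‖contractDir M‖ ^ 2 = 1 - 4 / hsSq M ^ 2 := by
  have hT : hsSq M ≠ 0 := by linarith [two_le_hsSq hM]
  rw [Matrix.det_fin_two] at hM
  rw [← Complex.normSq_eq_norm_sq, Complex.normSq_apply, contractDir]
  field_simp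
  unfold hsSq
  linear_combination (-4 * (M 0 0 * M 1 1 - M 0 1 * M 1 0) - 4) * hM

lemma vFull_zero (α : ℝ) : vFull α 0 = Real.cos (2 * Real.pi * α) := by simp [vFull]

lemma vFull_one (α : ℝ) : vFull α 1 = Real.sin (2 * Real.pi * α) := by simp [vFull]

lemma norm_vFull (α : ℝ) : ‖vFull α‖ = 1 := by
  have : ‖vFull α‖ ^ 2 = 1 := by
    rw [norm_sq_R2, vFull_zero, vFull_one, Real.cos_sq_add_sin_sq]
  nlinarith [norm_nonneg (vFull α)]

lemma vFull_ne_zero (α : ℝ) : vFull α ≠ 0 := by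
  rw [← norm_ne_zero_iff, norm_vFull]; exact one_ne_zero

lemma norm_mulVecE_vFull_sq {M : Matrix (Fin 2) (Fin 2) ℝ} (hM : M.det = 1) {z : ℂ} {α : ℝ}
    (hre : Real.cos (2 * (2 * Real.pi * α)) = z.re)
    (him : Real.sin (2 * (2 * Real.pi * α)) = z.im) :
    ‖mulVecE M (vFull α)‖ ^ 2 = hsSq M / 4 * ‖contractDir M - z‖ ^ 2 + 1 / hsSq M := by
  have hT : hsSq M ≠ 0 := by linarith [two_le_hsSq hM]
  have hz : z.re ^ 2 + z.im ^ 2 = 1 := by rw [← hre, ← him, Real.cos_sq_add_sin_sq]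
  have h1 := normSq_contractDir hM
  rw [← Complex.normSq_eq_norm_sq, Complex.normSq_apply] at h1
  have h2 : ‖contractDir M - z‖ ^ 2 =
      1 - 4 / hsSq M ^ 2 + 1 - 2 * ((contractDir M).re * z.re + (contractDir M).im * z.im) := by
    rw [← Complex.normSq_eq_norm_sq, Complex.normSq_apply, Complex.sub_re, Complex.sub_im]
    linear_combination h1 + hz
  rw [h2, norm_sq_R2, mulVecE_apply_zero, mulVecE_apply_one, vFull_zero, vFull_one, ← hre, ← him,
    Real.cos_two_mul, Real.sin_two_mul]
  have hcs := Real.cos_sq_add_sin_sq (2 * Real.pi * α)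
  set x := Real.cos (2 * Real.pi * α)
  set y := Real.sin (2 * Real.pi * α)
  simp only [contractDir]
  field_simp
  have hTe : hsSq M = M 0 0 ^ 2 + M 0 1 ^ 2 + M 1 0 ^ 2 + M 1 1 ^ 2 := rfl
  rw [hTe]
  linear_combination 4 * (M 0 0 ^ 2 + M 0 1 ^ 2 + M 1 0 ^ 2 + M 1 1 ^ 2) *
    (M 0 1 ^ 2 + M 1 1 ^ 2) * hcs

lemma re_contractDir_mul_identity {a b c d p q r s : ℝ} (hD : p * s - q * r = 1) :
    ((a * q + b * s) ^ 2 + (c * q + d * s) ^ 2 - ((a * p + b * r) ^ 2 + (c * p + d * r) ^ 2)) *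
        (p ^ 2 + q ^ 2 + r ^ 2 + s ^ 2) -
      ((a * p + b * r) ^ 2 + (a * q + b * s) ^ 2 + (c * p + d * r) ^ 2 + (c * q + d * s) ^ 2) *
        (q ^ 2 + s ^ 2 - (p ^ 2 + r ^ 2)) =
      -2 * ((a ^ 2 + c ^ 2 - (b ^ 2 + d ^ 2)) * (p * s + q * r) +
        2 * (a * b + c * d) * (r * s - p * q)) := by
  linear_combination (-2 * ((a ^ 2 + c ^ 2 - (b ^ 2 + d ^ 2)) * (p * s + q * r) +
    2 * (a * b + c * d) * (r * s - p * q))) * hD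

lemma im_contractDir_mul_identity {a b c d p q r s : ℝ} (hD : p * s - q * r = 1) :
    -(2 * ((a * p + b * r) * (a * q + b * s) + (c * p + d * r) * (c * q + d * s))) *
        (p ^ 2 + q ^ 2 + r ^ 2 + s ^ 2) -
      ((a * p + b * r) ^ 2 + (a * q + b * s) ^ 2 + (c * p + d * r) ^ 2 + (c * q + d * s) ^ 2) *
        -(2 * (p * q + r * s)) =
      -2 * ((a ^ 2 + c ^ 2 - (b ^ 2 + d ^ 2)) * (q * s - p * r) +
        (a * b + c * d) * (p ^ 2 - r ^ 2 - q ^ 2 + s ^ 2)) := by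
  linear_combination (-2 * ((a ^ 2 + c ^ 2 - (b ^ 2 + d ^ 2)) * (q * s - p * r) +
    (a * b + c * d) * (p ^ 2 - r ^ 2 - q ^ 2 + s ^ 2))) * hD

lemma abs_sq_sub_le (a b c d : ℝ) :
    |a ^ 2 + c ^ 2 - (b ^ 2 + d ^ 2)| ≤ a ^ 2 + b ^ 2 + c ^ 2 + d ^ 2 := by
  rw [abs_le]; constructor <;> nlinarith [sq_nonneg a, sq_nonneg b, sq_nonneg c, sq_nonneg d]

lemma two_mul_abs_mul_add_le (a b c d : ℝ) :
    2 * |a * b + c * d| ≤ a ^ 2 + b ^ 2 + c ^ 2 + d ^ 2 := by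
  rcases abs_cases (a * b + c * d) with h | h <;> rw [h.1] <;>
    nlinarith [sq_nonneg (a - b), sq_nonneg (c - d), sq_nonneg (a + b), sq_nonneg (c + d)]

lemma abs_neg_two_mul_add_div_le {x y x' y' S T T' : ℝ} (hT : 0 < T) (hT' : 0 < T')
    (hx : |x| ≤ S) (hx' : |x'| ≤ T) (hy : |y| ≤ S) (hy' : |y'| ≤ T) :
    |-2 * (x * x' + y * y') / (T' * T)| ≤ 4 * S / T' := by
  rw [abs_div, abs_mul, abs_of_pos (mul_pos hT' hT), div_le_div_iff₀ (mul_pos hT' hT) hT',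
    abs_neg, abs_two]
  have h1 := abs_add_le (x * x') (y * y')
  have h2 : |x * x'| ≤ S * T := by rw [abs_mul]; gcongr; exact (abs_nonneg x).trans hx
  have h3 : |y * y'| ≤ S * T := by rw [abs_mul]; gcongr; exact (abs_nonneg x).trans hx
  have : 2 * |x * x' + y * y'| ≤ 4 * S * T := by linarith
  nlinarith

lemma norm_contractDir_mul_sub_le {B M : Matrix (Fin 2) (Fin 2) ℝ} (hB : B.det = 1)
    (hM : M.det = 1) :
    ‖contractDir (B * M) - contractDir M‖ ≤ 8 * hsSq B / hsSq (B * M) := by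
  have hBM : (B * M).det = 1 := by rw [Matrix.det_mul, hB, hM, one_mul]
  have hT : 0 < hsSq M := by linarith [two_le_hsSq hM]
  have hT' : 0 < hsSq (B * M) := by linarith [two_le_hsSq hBM]
  rw [Matrix.det_fin_two] at hM
  have hre : (contractDir (B * M) - contractDir M).re =
      -2 * ((B 0 0 ^ 2 + B 1 0 ^ 2 - (B 0 1 ^ 2 + B 1 1 ^ 2)) * (M 0 0 * M 1 1 + M 0 1 * M 1 0) +
        2 * (B 0 0 * B 0 1 + B 1 0 * B 1 1) * (M 1 0 * M 1 1 - M 0 0 * M 0 1)) /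
        (hsSq (B * M) * hsSq M) := by
    rw [← re_contractDir_mul_identity hM]
    simp only [contractDir, Complex.sub_re]
    rw [div_sub_div _ _ hT'.ne' hT.ne']
    simp only [hsSq, Matrix.mul_apply, Fin.sum_univ_two]
  have him : (contractDir (B * M) - contractDir M).im =
      -2 * ((B 0 0 ^ 2 + B 1 0 ^ 2 - (B 0 1 ^ 2 + B 1 1 ^ 2)) * (M 0 1 * M 1 1 - M 0 0 * M 1 0) +
        (B 0 0 * B 0 1 + B 1 0 * B 1 1) * (M 0 0 ^ 2 - M 1 0 ^ 2 - M 0 1 ^ 2 + M 1 1 ^ 2)) /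
        (hsSq (B * M) * hsSq M) := by
    rw [← im_contractDir_mul_identity hM]
    simp only [contractDir, Complex.sub_im]
    rw [div_sub_div _ _ hT'.ne' hT.ne']
    simp only [hsSq, Matrix.mul_apply, Fin.sum_univ_two]
  have hS : hsSq B = B 0 0 ^ 2 + B 0 1 ^ 2 + B 1 0 ^ 2 + B 1 1 ^ 2 := rfl
  have hTe : hsSq M = M 0 0 ^ 2 + M 0 1 ^ 2 + M 1 0 ^ 2 + M 1 1 ^ 2 := rfl
  have hg := hS ▸ abs_sq_sub_le (B 0 0) (B 0 1) (B 1 0) (B 1 1)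
  have hk := hS ▸ two_mul_abs_mul_add_le (B 0 0) (B 0 1) (B 1 0) (B 1 1)
  have b1 : |M 0 0 * M 1 1 + M 0 1 * M 1 0| ≤ hsSq M := by
    have := two_mul_abs_mul_add_le (M 0 0) (M 1 1) (M 0 1) (M 1 0)
    have := abs_nonneg (M 0 0 * M 1 1 + M 0 1 * M 1 0)
    linarith
  have b2 : |M 1 0 * M 1 1 - M 0 0 * M 0 1| ≤ hsSq M := by
    have h := two_mul_abs_mul_add_le (M 1 0) (M 1 1) (-M 0 0) (M 0 1)
    have h' := abs_nonneg (M 1 0 * M 1 1 - M 0 0 * M 0 1)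
    rw [neg_mul, ← sub_eq_add_neg, neg_sq] at h
    linarith
  have b3 : |M 0 1 * M 1 1 - M 0 0 * M 1 0| ≤ hsSq M := by
    have h := two_mul_abs_mul_add_le (M 0 1) (M 1 1) (-M 0 0) (M 1 0)
    have h' := abs_nonneg (M 0 1 * M 1 1 - M 0 0 * M 1 0)
    rw [neg_mul, ← sub_eq_add_neg, neg_sq] at h
    linarith
  have b4 : |M 0 0 ^ 2 - M 1 0 ^ 2 - M 0 1 ^ 2 + M 1 1 ^ 2| ≤ hsSq M := by
    have h := abs_sq_sub_le (M 0 0) (M 1 0) (M 1 1) (M 0 1)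
    have e : M 0 0 ^ 2 + M 1 1 ^ 2 - (M 1 0 ^ 2 + M 0 1 ^ 2) =
      M 0 0 ^ 2 - M 1 0 ^ 2 - M 0 1 ^ 2 + M 1 1 ^ 2 := by ring
    rw [e] at h
    linarith
  have hk2 : |2 * (B 0 0 * B 0 1 + B 1 0 * B 1 1)| ≤ hsSq B := by rwa [abs_mul, abs_two]
  have hk1 : |B 0 0 * B 0 1 + B 1 0 * B 1 1| ≤ hsSq B := by
    linarith [abs_nonneg (B 0 0 * B 0 1 + B 1 0 * B 1 1)]
  calc ‖contractDir (B * M) - contractDir M‖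
      ≤ |(contractDir (B * M) - contractDir M).re| + |(contractDir (B * M) - contractDir M).im| :=
        Complex.norm_le_abs_re_add_abs_im _
    _ ≤ 4 * hsSq B / hsSq (B * M) + 4 * hsSq B / hsSq (B * M) := by
        rw [hre, him]
        exact add_le_add (abs_neg_two_mul_add_div_le hT hT' hg b1 hk2 b2)
          (abs_neg_two_mul_add_div_le hT hT' hg b3 hk1 b4)
    _ = 8 * hsSq B / hsSq (B * M) := by ring

lemma eventually_const_mul_exp_le (C : ℝ) {a b : ℝ} (hab : a < b) :
    ∀ᶠ n : ℕ in atTop, C * Real.exp (a * n) ≤ Real.exp (b * n) := by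
  have h : Tendsto (fun n : ℕ => Real.exp ((b - a) * n)) atTop atTop :=
    Real.tendsto_exp_atTop.comp (tendsto_natCast_atTop_atTop.const_mul_atTop (sub_pos.mpr hab))
  filter_upwards [h.eventually_ge_atTop C] with n hn
  calc C * Real.exp (a * n) ≤ Real.exp ((b - a) * n) * Real.exp (a * n) :=
        mul_le_mul_of_nonneg_right hn (Real.exp_pos _).le
    _ = Real.exp (b * n) := by rw [← Real.exp_add]; ring_nf

/-- A product of bounded unimodular matrices growing at the exact rate `lam` has a direction which
is contracted at rate `lam`. -/
lemma exists_contracted_direction {M B : ℕ → Matrix (Fin 2) (Fin 2) ℝ}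
    (hMB : ∀ n, M (n + 1) = B n * M n) (hB : ∀ n, (B n).det = 1) (hM : ∀ n, (M n).det = 1)
    {c : ℝ} (hc : ∀ n, hsSq (B n) ≤ c) {lam : ℝ} (hpos : 0 < lam)
    (hlow : ∀ a < lam, ∀ᶠ n : ℕ in atTop, Real.exp (a * n) ≤ opNorm (M n))
    (hup : ∀ b > lam, ∀ᶠ n : ℕ in atTop, opNorm (M n) ≤ Real.exp (b * n)) :
    ∃ z : ℂ, ‖z‖ = 1 ∧ Tendsto (fun n => contractDir (M n)) atTop (𝓝 z) ∧
      ∀ α : ℝ, Real.cos (2 * (2 * Real.pi * α)) = z.re →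
        Real.sin (2 * (2 * Real.pi * α)) = z.im → ∀ a < lam,
          ∀ᶠ n : ℕ in atTop, ‖mulVecE (M n) (vFull α)‖ ≤ Real.exp (-a * n) := by
  have hT (n : ℕ) : 2 ≤ hsSq (M n) := two_le_hsSq (hM n)
  have hTlow : ∀ a < lam, ∀ᶠ n : ℕ in atTop, Real.exp (a * n) ^ 2 ≤ hsSq (M n) := by
    intro a ha
    filter_upwards [hlow a ha] with n hn
    exact (pow_le_pow_left₀ (Real.exp_pos _).le hn 2).trans (opNorm_sq_le_hsSq _)
  have hstep (n : ℕ) : dist (contractDir (M n)) (contractDir (M (n + 1))) ≤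
      8 * c / hsSq (M (n + 1)) := by
    rw [dist_comm, dist_eq_norm, hMB]
    refine (norm_contractDir_mul_sub_le (hB n) (hM n)).trans ?_
    refine div_le_div_of_nonneg_right (by linarith [hc n]) ?_
    rw [← hMB]; linarith [hT (n + 1)]
  have hc0 : 0 ≤ c := by linarith [two_le_hsSq (hB 0), hc 0]
  have hgeom : ∀ a, 0 < a → a < lam →
      ∃ C, ∀ n, dist (contractDir (M n)) (contractDir (M (n + 1))) ≤ C * Real.exp (-2 * a) ^ n := by
    intro a ha0 ha
    have hO : (fun n => dist (contractDir (M n)) (contractDir (M (n + 1)))) =O[atTop]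
        fun n : ℕ => Real.exp (-2 * a) ^ n := by
      refine Asymptotics.IsBigO.of_bound (8 * c) ?_
      filter_upwards [(tendsto_add_atTop_nat 1).eventually (hTlow a ha)] with n hn
      rw [Real.norm_of_nonneg dist_nonneg, Real.norm_of_nonneg (by positivity)]
      refine (hstep n).trans ?_
      rw [div_le_iff₀ (by linarith [hT (n + 1)]), mul_assoc]
      refine le_mul_of_one_le_right (by positivity) ?_
      have h1 : (1 : ℝ) ≤ Real.exp (-2 * a) ^ n * Real.exp (a * (n + 1 : ℕ)) ^ 2 := by
        rw [← Real.exp_nat_mul, ← Real.exp_nat_mul, ← Real.exp_add]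
        apply Real.one_le_exp
        push_cast
        nlinarith
      exact h1.trans (mul_le_mul_of_nonneg_left hn (by positivity))
    obtain ⟨C, _, hC⟩ := Asymptotics.bound_of_isBigO_nat_atTop hO
    refine ⟨C, fun n => ?_⟩
    have := @hC n (by positivity)
    rwa [Real.norm_of_nonneg dist_nonneg, Real.norm_of_nonneg (by positivity)] at this
  have hr {a : ℝ} (ha : 0 < a) : Real.exp (-2 * a) < 1 := by
    rw [Real.exp_lt_one_iff]; linarith
  obtain ⟨C₀, hC₀⟩ := hgeom (lam / 2) (by linarith) (by linarith)
  obtain ⟨z, hz⟩ := cauchySeq_tendsto_of_complete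
    (cauchySeq_of_le_geometric _ C₀ (hr (show 0 < lam / 2 by linarith)) hC₀)
  refine ⟨z, ?_, hz, ?_⟩
  · have h1 : Tendsto (fun n => ‖contractDir (M n)‖ ^ 2) atTop (𝓝 (‖z‖ ^ 2)) := hz.norm.pow 2
    have h2 : Tendsto (fun n => ‖contractDir (M n)‖ ^ 2) atTop (𝓝 (1 - 0)) := by
      simp_rw [normSq_contractDir (hM _)]
      refine tendsto_const_nhds.sub ?_
      have h3 : Tendsto (fun n : ℕ => Real.exp (lam / 2 * n)) atTop atTop :=
        Real.tendsto_exp_atTop.comp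
          (tendsto_natCast_atTop_atTop.const_mul_atTop (by linarith : 0 < lam / 2))
      have h4 : Tendsto (fun n => hsSq (M n)) atTop atTop :=
        tendsto_atTop_mono' _ (hTlow (lam / 2) (by linarith))
          ((tendsto_pow_atTop two_ne_zero).comp h3)
      exact tendsto_const_nhds.div_atTop ((tendsto_pow_atTop two_ne_zero).comp h4)
    have h5 := tendsto_nhds_unique h1 h2
    nlinarith [norm_nonneg z]
  · intro α hre him a ha
    obtain ⟨δ, hδ0, hδ1, hδ2⟩ : ∃ δ, 0 < δ ∧ δ < lam ∧ δ ≤ (lam - a) / 6 := by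
      refine ⟨min (lam / 2) ((lam - a) / 6), lt_min (by linarith) (by linarith), ?_,
        min_le_right _ _⟩
      exact (min_le_left _ _).trans_lt (by linarith)
    obtain ⟨C, hC⟩ := hgeom (lam - δ) (by linarith) (by linarith)
    have hdist (n : ℕ) := dist_le_of_le_geometric_of_tendsto _ C (hr (sub_pos.mpr hδ1)) hC hz n
    set D := C / (1 - Real.exp (-2 * (lam - δ))) with hD
    filter_upwards [hTlow (lam - δ) (by linarith), hup (lam + δ) (by linarith),
      eventually_const_mul_exp_le (D ^ 2 / 2 + 1)
        (show -2 * (lam - 3 * δ) < -2 * a by linarith)] with n h1 h2 h3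
    apply le_of_sq_le_sq _ (Real.exp_pos _).le
    rw [norm_mulVecE_vFull_sq (hM n) hre him]
    have h4 : hsSq (M n) ≤ 2 * Real.exp ((lam + δ) * n) ^ 2 :=
      (hsSq_le _).trans (by
        have := pow_le_pow_left₀ (opNorm_nonneg _) h2 2
        linarith)
    have h5 : ‖contractDir (M n) - z‖ ^ 2 ≤ (D * Real.exp (-2 * (lam - δ)) ^ n) ^ 2 := by
      refine pow_le_pow_left₀ (norm_nonneg _) ?_ 2
      rw [← dist_eq_norm]
      refine (hdist n).trans_eq ?_
      rw [hD]; ring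
    have h6 : 1 / hsSq (M n) ≤ Real.exp (-2 * (lam - 3 * δ) * n) := by
      rw [div_le_iff₀ (by linarith [hT n])]
      refine le_trans ?_ (mul_le_mul_of_nonneg_left h1 (Real.exp_pos _).le)
      rw [← Real.exp_nat_mul, ← Real.exp_add]
      apply Real.one_le_exp
      have : (0 : ℝ) ≤ n := by positivity
      push_cast
      nlinarith
    have h7 : hsSq (M n) / 4 * ‖contractDir (M n) - z‖ ^ 2 ≤
        D ^ 2 / 2 * Real.exp (-2 * (lam - 3 * δ) * n) := by
      calc hsSq (M n) / 4 * ‖contractDir (M n) - z‖ ^ 2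
          ≤ (2 * Real.exp ((lam + δ) * n) ^ 2) / 4 * (D * Real.exp (-2 * (lam - δ)) ^ n) ^ 2 := by
            gcongr
        _ = D ^ 2 / 2 * (Real.exp ((lam + δ) * n) ^ 2 * (Real.exp (-2 * (lam - δ)) ^ n) ^ 2) := by
            ring
        _ = D ^ 2 / 2 * Real.exp (-2 * (lam - 3 * δ) * n) := by
            congr 1
            rw [← pow_mul, ← Real.exp_nat_mul, ← Real.exp_nat_mul, ← Real.exp_add]
            congr 1
            push_cast
            ring
    calc _ ≤ (D ^ 2 / 2 + 1) * Real.exp (-2 * (lam - 3 * δ) * n) := by linarith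
      _ ≤ Real.exp (-2 * a * n) := h3
      _ = Real.exp (-a * n) ^ 2 := by
          rw [← Real.exp_nat_mul]; congr 1; push_cast; ring

/-- The angle in `[0,1/2)` whose doubled direction is `z`. -/
def halfAngle (z : ℂ) : ℝ := Int.fract (Complex.arg z / (2 * Real.pi)) / 2

lemma measurable_halfAngle : Measurable halfAngle :=
  ((Complex.measurable_arg.div_const _).fract).div_const _

lemma halfAngle_mem (z : ℂ) : halfAngle z ∈ Ico (0 : ℝ) (1 / 2) := by
  have h1 := Int.fract_nonneg (Complex.arg z / (2 * Real.pi))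
  have h2 := Int.fract_lt_one (Complex.arg z / (2 * Real.pi))
  constructor <;> unfold halfAngle <;> linarith

lemma two_mul_halfAngle (z : ℂ) : 2 * (2 * Real.pi * halfAngle z) =
    Complex.arg z - ⌊Complex.arg z / (2 * Real.pi)⌋ * (2 * Real.pi) := by
  have := Real.pi_pos
  unfold halfAngle Int.fract
  field_simp

lemma cos_halfAngle {z : ℂ} (hz : ‖z‖ = 1) : Real.cos (2 * (2 * Real.pi * halfAngle z)) = z.re := by
  rw [two_mul_halfAngle, Real.cos_sub_int_mul_two_pi,
    Complex.cos_arg (by rw [← norm_ne_zero_iff, hz]; exact one_ne_zero), hz, div_one]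

lemma sin_halfAngle {z : ℂ} (hz : ‖z‖ = 1) : Real.sin (2 * (2 * Real.pi * halfAngle z)) = z.im := by
  rw [two_mul_halfAngle, Real.sin_sub_int_mul_two_pi, Complex.sin_arg, hz, div_one]

lemma ae_forall_lt {Θ : Type*} [MeasurableSpace Θ] {m : Measure Θ} {lam : ℝ} {p : ℝ → Θ → Prop}
    (hmono : ∀ a b θ, a ≤ b → p b θ → p a θ) (h : ∀ a < lam, ∀ᵐ θ ∂m, p a θ) :
    ∀ᵐ θ ∂m, ∀ a < lam, p a θ := by
  have : ∀ᵐ θ ∂m, ∀ q : ℚ, (q : ℝ) < lam → p q θ := by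
    rw [ae_all_iff]
    intro q
    by_cases hq : (q : ℝ) < lam
    · filter_upwards [h q hq] with θ hθ _ using hθ
    · exact ae_of_all _ fun θ hq' => absurd hq' hq
  filter_upwards [this] with θ hθ a ha
  obtain ⟨q, hq1, hq2⟩ := exists_rat_btwn ha
  exact hmono a q θ hq1.le (hθ q hq2)

section Oseledets

variable {Θ : Type*} [MeasurableSpace Θ] {γ : Θ → Θ} {m : Measure Θ} [IsProbabilityMeasure m]
  {A : Θ → Matrix (Fin 2) (Fin 2) ℝ}

/-- Existence of a measurable stable direction for a bounded unimodular cocycle with positive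
Lyapunov exponent. -/
lemma exists_stable_angle (herg : Ergodic γ m) (hdet : ∀ θ, (A θ).det = 1)
    (hAmeas : ∀ i j, Measurable fun θ => A θ i j) {C : ℝ} (hC : ∀ θ, opNorm (A θ) ≤ C) {lam : ℝ}
    (hlam : Tendsto (fun n : ℕ => (∫ θ, Real.log (opNorm (coc γ A n θ)) ∂m) / n) atTop (𝓝 lam))
    (hpos : 0 < lam) :
    ∃ α : Θ → ℝ, Measurable α ∧ (∀ θ, α θ ∈ Ico (0 : ℝ) (1 / 2)) ∧
      ∀ᵐ θ ∂m, ∀ a < lam, ∀ᶠ n : ℕ in atTop,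
        ‖mulVecE (coc γ A n θ) (vFull (α θ))‖ ≤ Real.exp (-a * n) := by
  have h1 (n : ℕ) (θ : Θ) : 1 ≤ opNorm (coc γ A n θ) := one_le_opNorm (det_coc hdet n θ)
  have hp (n : ℕ) (θ : Θ) : 0 < opNorm (coc γ A n θ) := zero_lt_one.trans_le (h1 n θ)
  have hmeas (n : ℕ) : Measurable fun θ => Real.log (opNorm (coc γ A n θ)) :=
    Real.measurable_log.comp (measurable_opNorm (measurable_coc herg.measurable hAmeas n))
  have h0 (n : ℕ) (θ : Θ) : 0 ≤ Real.log (opNorm (coc γ A n θ)) := Real.log_nonneg (h1 n θ)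
  have hK (n : ℕ) (θ : Θ) : Real.log (opNorm (coc γ A n θ)) ≤ n * Real.log C := by
    rw [← Real.log_pow]
    exact Real.log_le_log (hp n θ) (opNorm_coc_le hC n θ)
  have hsub (n k : ℕ) (θ : Θ) : Real.log (opNorm (coc γ A (n + k) θ)) ≤
      Real.log (opNorm (coc γ A n θ)) + Real.log (opNorm (coc γ A k (γ^[n] θ))) := by
    rw [add_comm (Real.log (opNorm (coc γ A n θ))), ← Real.log_mul (hp _ _).ne' (hp _ _).ne',
      coc_add]
    refine Real.log_le_log ?_ (opNorm_mul_le _ _)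
    rw [← coc_add]; exact hp _ _
  have hlow : ∀ᵐ θ ∂m, ∀ a < lam, ∀ᶠ n : ℕ in atTop,
      Real.exp (a * n) ≤ opNorm (coc γ A n θ) := by
    refine ae_forall_lt (fun a b θ hab hb => ?_) fun a ha => ?_
    · filter_upwards [hb] with n hn
      exact (Real.exp_le_exp.mpr (mul_le_mul_of_nonneg_right hab (by positivity))).trans hn
    · filter_upwards [eventually_ge_of_lt_mean_rate herg hmeas h0 hK hsub hlam ha] with θ hθ
      filter_upwards [hθ] with n hn
      exact (Real.le_log_iff_exp_le (hp n θ)).mp hn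
  have hup : ∀ᵐ θ ∂m, ∀ b < -lam, ∀ᶠ n : ℕ in atTop,
      opNorm (coc γ A n θ) ≤ Real.exp (-b * n) := by
    refine ae_forall_lt (fun a b θ hab hb => ?_) fun a ha => ?_
    · filter_upwards [hb] with n hn
      exact hn.trans
        (Real.exp_le_exp.mpr (mul_le_mul_of_nonneg_right (neg_le_neg hab) (by positivity)))
    · filter_upwards [eventually_le_of_mean_rate_lt herg hmeas h0 hK hsub hlam
        (show lam < -a by linarith)] with θ hθ
      filter_upwards [hθ] with n hn
      exact (Real.log_le_iff_le_exp (hp n θ)).mp hn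
  have hall : ∀ᵐ θ ∂m, ∃ z : ℂ, ‖z‖ = 1 ∧
      Tendsto (fun n => contractDir (coc γ A n θ)) atTop (𝓝 z) ∧
      ∀ α : ℝ, Real.cos (2 * (2 * Real.pi * α)) = z.re →
        Real.sin (2 * (2 * Real.pi * α)) = z.im → ∀ a < lam,
          ∀ᶠ n : ℕ in atTop, ‖mulVecE (coc γ A n θ) (vFull α)‖ ≤ Real.exp (-a * n) := by
    filter_upwards [hlow, hup] with θ hl hu
    refine exists_contracted_direction (B := fun n => A (γ^[n] θ)) (c := 2 * C ^ 2)
      (fun n => coc_succ n θ) (fun n => hdet _) (fun n => det_coc hdet n θ) (fun n => ?_) hpos hl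
      fun b hb => ?_
    · refine (hsSq_le _).trans ?_
      have := pow_le_pow_left₀ (opNorm_nonneg _) (hC (γ^[n] θ)) 2
      linarith
    · simpa using hu (-b) (by linarith)
  have hzmeas (n : ℕ) : Measurable fun θ => contractDir (coc γ A n θ) := by
    have hc := measurable_coc herg.measurable hAmeas n
    have hT : Measurable fun θ => hsSq (coc γ A n θ) :=
      ((((hc 0 0).pow_const 2).add ((hc 0 1).pow_const 2)).add ((hc 1 0).pow_const 2)).add
        ((hc 1 1).pow_const 2)
    apply measurable_of_re_im
    · exact ((((hc 0 1).pow_const 2).add ((hc 1 1).pow_const 2)).sub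
        (((hc 0 0).pow_const 2).add ((hc 1 0).pow_const 2))).div hT
    · exact ((((hc 0 0).mul (hc 0 1)).add ((hc 1 0).mul (hc 1 1))).const_mul 2).neg.div hT
  obtain ⟨z, hzm, hz⟩ := measurable_limit_of_tendsto_metrizable_ae
    (fun n => (hzmeas n).aemeasurable) (hall.mono fun θ ⟨z, _, h, _⟩ => ⟨z, h⟩)
  refine ⟨fun θ => halfAngle (z θ), measurable_halfAngle.comp hzm, fun θ => halfAngle_mem _, ?_⟩
  filter_upwards [hall, hz] with θ ⟨z', hz'1, hz', hdec⟩ hzθ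
  have : z θ = z' := tendsto_nhds_unique hzθ hz'
  rw [this]
  exact hdec _ (cos_halfAngle hz'1) (sin_halfAngle hz'1)

end Oseledets

lemma eventually_exp_le_norm_of_wedge_ne_zero {M : ℕ → Matrix (Fin 2) (Fin 2) ℝ}
    (hM : ∀ n, (M n).det = 1) {s v : R2} {lam : ℝ}
    (hs : ∀ a < lam, ∀ᶠ n : ℕ in atTop, ‖mulVecE (M n) s‖ ≤ Real.exp (-a * n))
    (hw : wedge v s ≠ 0) :
    ∀ a < lam, ∀ᶠ n : ℕ in atTop, Real.exp (a * n) ≤ ‖mulVecE (M n) v‖ := by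
  intro a ha
  obtain ⟨b, hab, hb⟩ := exists_between ha
  have hw' : 0 < |wedge v s| := abs_pos.mpr hw
  filter_upwards [hs b hb, eventually_const_mul_exp_le |wedge v s|⁻¹ hab] with n h1 h2
  have h3 : |wedge v s| ≤ ‖mulVecE (M n) v‖ * Real.exp (-b * n) := by
    rw [← wedge_mulVecE (hM n)]
    exact (abs_wedge_le _ _).trans (mul_le_mul_of_nonneg_left h1 (norm_nonneg _))
  rw [inv_mul_le_iff₀ hw'] at h2
  refine h2.trans ?_
  calc |wedge v s| * Real.exp (b * n)
      ≤ ‖mulVecE (M n) v‖ * Real.exp (-b * n) * Real.exp (b * n) :=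
        mul_le_mul_of_nonneg_right h3 (Real.exp_pos _).le
    _ = ‖mulVecE (M n) v‖ := by rw [mul_assoc, ← Real.exp_add]; simp

lemma mulVecE_inv_mulVecE {M : Matrix (Fin 2) (Fin 2) ℝ} (hM : M.det = 1) (v : R2) :
    mulVecE M⁻¹ (mulVecE M v) = v := by
  rw [← mulVecE_mul, Matrix.nonsing_inv_mul _ (by rw [hM]; exact isUnit_one), mulVecE_one]

section Splitting

variable {Θ : Type*} {γ : Θ ≃ Θ} {A : Θ → Matrix (Fin 2) (Fin 2) ℝ}

lemma det_invGen (hdet : ∀ θ, (A θ).det = 1) (θ : Θ) : (invGen γ A θ).det = 1 :=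
  det_inv_eq_one (hdet _)

lemma mulVecE_coc_invGen_succ_apply (hdet : ∀ θ, (A θ).det = 1) (n : ℕ) (θ : Θ) (v : R2) :
    mulVecE (coc (⇑γ.symm) (invGen γ A) (n + 1) (γ θ)) (mulVecE (A θ) v) =
      mulVecE (coc (⇑γ.symm) (invGen γ A) n θ) v := by
  rw [mulVecE_coc_succ, invGen, γ.symm_apply_apply, mulVecE_inv_mulVecE (hdet θ)]

/-- A line field that decays along backward orbits is invariant. -/
lemma wedge_mulVecE_unstable_eq_zero (hdet : ∀ θ, (A θ).det = 1) {lam : ℝ} (hpos : 0 < lam)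
    {e e' : R2} {θ : Θ}
    (h : ∀ a < lam, ∀ᶠ n : ℕ in atTop,
      ‖mulVecE (coc (⇑γ.symm) (invGen γ A) n θ) e‖ ≤ Real.exp (-a * n))
    (h' : ∀ a < lam, ∀ᶠ n : ℕ in atTop,
      ‖mulVecE (coc (⇑γ.symm) (invGen γ A) n (γ θ)) e'‖ ≤ Real.exp (-a * n)) :
    wedge (mulVecE (A θ) e) e' = 0 := by
  by_contra hw
  have h1 := eventually_exp_le_norm_of_wedge_ne_zero
    (fun n => det_coc (det_invGen hdet) n (γ θ)) h' hw (lam / 2) (by linarith)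
  have h2 := (tendsto_add_atTop_nat 1).eventually h1
  obtain ⟨n, hn1, hn2⟩ := (h2.and (h (lam / 2) (by linarith))).exists
  rw [mulVecE_coc_invGen_succ_apply hdet] at hn1
  have h3 := Real.exp_le_exp.mp (hn1.trans hn2)
  push_cast at h3
  nlinarith [(Nat.cast_nonneg n : (0 : ℝ) ≤ n)]

/-- An invariant line field is transported by the iterated cocycle. -/
lemma exists_coc_unstable_eq_smul {e : Θ → R2}
    (he : ∀ θ, e θ ≠ 0) {θ : Θ}
    (h : ∀ n : ℕ, wedge (mulVecE (A ((⇑γ)^[n] θ)) (e ((⇑γ)^[n] θ))) (e ((⇑γ)^[n + 1] θ)) = 0)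
    (n : ℕ) : ∃ t : ℝ, mulVecE (coc (⇑γ) A n θ) (e θ) = t • e ((⇑γ)^[n] θ) := by
  induction n with
  | zero => exact ⟨1, by simp [coc, mulVecE_one]⟩
  | succ n ih =>
    obtain ⟨t, ht⟩ := ih
    obtain ⟨s, hs⟩ := eq_smul_of_wedge_eq_zero (he _) (h n)
    refine ⟨t * s, ?_⟩
    rw [coc_succ, mulVecE_mul, ht, mulVecE_smul, hs, smul_smul]

lemma norm_coc_mul_norm_coc_invGen (hdet : ∀ θ, (A θ).det = 1) {e : Θ → R2}
    (he : ∀ θ, ‖e θ‖ = 1) {θ : Θ} {n : ℕ} {t : ℝ}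
    (ht : mulVecE (coc (⇑γ) A n θ) (e θ) = t • e ((⇑γ)^[n] θ)) :
    ‖mulVecE (coc (⇑γ) A n θ) (e θ)‖ *
      ‖mulVecE (coc (⇑γ.symm) (invGen γ A) n ((⇑γ)^[n] θ)) (e ((⇑γ)^[n] θ))‖ = 1 := by
  have h1 : t • mulVecE (coc (⇑γ.symm) (invGen γ A) n ((⇑γ)^[n] θ)) (e ((⇑γ)^[n] θ)) = e θ := by
    rw [← mulVecE_smul, ← ht, coc_invGen, symm_iterate_apply,
      mulVecE_inv_mulVecE (det_coc hdet n θ)]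
  have h2 := congrArg norm h1
  rw [norm_smul, he] at h2
  rw [ht, norm_smul, he, mul_one, h2]

variable [MeasurableSpace Θ] {m : Measure Θ}

lemma measurable_invGen (hγ' : Measurable ⇑γ.symm) (hdet : ∀ θ, (A θ).det = 1)
    (hAmeas : ∀ i j, Measurable fun θ => A θ i j) (i j : Fin 2) :
    Measurable fun θ => invGen γ A θ i j := by
  simp_rw [invGen, inv_apply_of_det_eq_one (hdet _)]
  fin_cases i <;> fin_cases j
  · exact (hAmeas 1 1).comp hγ'
  · exact ((hAmeas 0 1).comp hγ').neg
  · exact ((hAmeas 1 0).comp hγ').neg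
  · exact (hAmeas 0 0).comp hγ'

lemma ergodic_symm (hγ' : Measurable ⇑γ.symm) (herg : Ergodic ⇑γ m) : Ergodic ⇑γ.symm m :=
  Ergodic.symm (e := (⟨γ, herg.measurable, hγ'⟩ : Θ ≃ᵐ Θ)) herg

lemma measurable_vFull {α : Θ → ℝ} (hα : Measurable α) (i : Fin 2) :
    Measurable fun θ => vFull (α θ) i := by
  fin_cases i
  · simp only [Fin.zero_eta, vFull_zero]; exact Real.measurable_cos.comp (hα.const_mul _)
  · simp only [Fin.mk_one, vFull_one]; exact Real.measurable_sin.comp (hα.const_mul _)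

lemma measurable_norm_mulVecE_vFull {M : Θ → Matrix (Fin 2) (Fin 2) ℝ}
    (hM : ∀ i j, Measurable fun θ => M θ i j) {α : Θ → ℝ} (hα : Measurable α) :
    Measurable fun θ => ‖mulVecE (M θ) (vFull (α θ))‖ := by
  have h (θ : Θ) : ‖mulVecE (M θ) (vFull (α θ))‖ =
      √((M θ 0 0 * vFull (α θ) 0 + M θ 0 1 * vFull (α θ) 1) ^ 2 +
        (M θ 1 0 * vFull (α θ) 0 + M θ 1 1 * vFull (α θ) 1) ^ 2) := by
    rw [← mulVecE_apply_zero, ← mulVecE_apply_one, ← norm_sq_R2, Real.sqrt_sq (norm_nonneg _)]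
  simp_rw [h]
  have hv := measurable_vFull hα
  exact (((((hM 0 0).mul (hv 0)).add ((hM 0 1).mul (hv 1))).pow_const 2).add
    ((((hM 1 0).mul (hv 0)).add ((hM 1 1).mul (hv 1))).pow_const 2)).sqrt

variable [IsProbabilityMeasure m]

/-- Existence of a measurable unstable direction. -/
lemma exists_unstable_angle (hγ' : Measurable ⇑γ.symm) (herg : Ergodic ⇑γ m)
    (hdet : ∀ θ, (A θ).det = 1) (hAmeas : ∀ i j, Measurable fun θ => A θ i j) {C : ℝ}
    (hC : ∀ θ, opNorm (A θ) ≤ C) {lam : ℝ}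
    (hlam : Tendsto (fun n : ℕ => (∫ θ, Real.log (opNorm (coc ⇑γ A n θ)) ∂m) / n) atTop (𝓝 lam))
    (hpos : 0 < lam) :
    ∃ α : Θ → ℝ, Measurable α ∧ (∀ θ, α θ ∈ Ico (0 : ℝ) (1 / 2)) ∧
      ∀ᵐ θ ∂m, ∀ a < lam, ∀ᶠ n : ℕ in atTop,
        ‖mulVecE (coc (⇑γ.symm) (invGen γ A) n θ) (vFull (α θ))‖ ≤ Real.exp (-a * n) := by
  have hsymm := ergodic_symm hγ' herg
  refine exists_stable_angle hsymm (det_invGen hdet) (measurable_invGen hγ' hdet hAmeas)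
    (C := C) (fun θ => (opNorm_inv_le (hdet _)).trans (hC _)) ?_ hpos
  convert hlam using 3 with n
  have h1 (θ : Θ) : Real.log (opNorm (coc (⇑γ.symm) (invGen γ A) n θ)) =
      Real.log (opNorm (coc (⇑γ) A n ((⇑γ.symm)^[n] θ))) := by
    rw [coc_invGen, opNorm_inv (det_coc hdet _ _)]
  simp_rw [h1]
  have hmp := hsymm.toMeasurePreserving.iterate n
  have hmeas : Measurable fun θ => Real.log (opNorm (coc ⇑γ A n θ)) :=
    Real.measurable_log.comp (measurable_opNorm (measurable_coc herg.measurable hAmeas n))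
  conv_rhs => rw [← hmp.map_eq]
  exact (integral_map hmp.measurable.aemeasurable hmeas.aestronglyMeasurable).symm

/-- The stable and unstable directions are transverse almost everywhere. -/
lemma ae_wedge_ne_zero (hγ' : Measurable ⇑γ.symm) (herg : Ergodic ⇑γ m)
    (hdet : ∀ θ, (A θ).det = 1) (hAmeas : ∀ i j, Measurable fun θ => A θ i j)
    {lam : ℝ} (hpos : 0 < lam) {αu αs : Θ → ℝ} (hαu : Measurable αu)
    (hs : ∀ᵐ θ ∂m, ∀ a < lam, ∀ᶠ n : ℕ in atTop,
      ‖mulVecE (coc (⇑γ) A n θ) (vFull (αs θ))‖ ≤ Real.exp (-a * n))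
    (hu : ∀ᵐ θ ∂m, ∀ a < lam, ∀ᶠ n : ℕ in atTop,
      ‖mulVecE (coc (⇑γ.symm) (invGen γ A) n θ) (vFull (αu θ))‖ ≤ Real.exp (-a * n))
    (hinv : ∀ᵐ θ ∂m, wedge (mulVecE (A θ) (vFull (αu θ))) (vFull (αu (γ θ))) = 0) :
    ∀ᵐ θ ∂m, wedge (vFull (αu θ)) (vFull (αs θ)) ≠ 0 := by
  have hlim : Tendsto (fun n : ℕ => Real.exp (-(lam / 2) * n)) atTop (𝓝 0) :=
    Real.tendsto_exp_atBot.comp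
      (tendsto_natCast_atTop_atTop.const_mul_atTop_of_neg (by linarith))
  set f : ℕ → Θ → ℝ := fun n θ =>
    ‖mulVecE (coc (⇑γ.symm) (invGen γ A) n θ) (vFull (αu θ))‖ with hf
  have hfm (n : ℕ) : Measurable (f n) := measurable_norm_mulVecE_vFull
    (measurable_coc hγ' (measurable_invGen hγ' hdet hAmeas) n) hαu
  have hf0 : TendstoInMeasure m f atTop fun _ => (0 : ℝ) := by
    refine tendstoInMeasure_of_tendsto_ae (fun n => (hfm n).aestronglyMeasurable) ?_
    filter_upwards [hu] with θ hθ
    exact squeeze_zero' (Eventually.of_forall fun n => norm_nonneg _)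
      (hθ (lam / 2) (by linarith)) hlim
  have hf1 : TendstoInMeasure m (fun n θ => f n ((⇑γ)^[n] θ)) atTop fun _ => (0 : ℝ) := by
    intro ε hε
    refine (hf0 ε hε).congr fun n => ?_
    have hset : MeasurableSet {θ | ε ≤ edist (f n θ) 0} :=
      measurableSet_le measurable_const ((hfm n).edist measurable_const)
    exact ((herg.toMeasurePreserving.iterate n).measure_preimage hset.nullMeasurableSet).symm
  obtain ⟨ns, hns, hae⟩ := hf1.exists_seq_tendsto_ae
  have hinv' : ∀ᵐ θ ∂m, ∀ n : ℕ, wedge (mulVecE (A ((⇑γ)^[n] θ)) (vFull (αu ((⇑γ)^[n] θ))))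
      (vFull (αu ((⇑γ)^[n + 1] θ))) = 0 := by
    rw [ae_all_iff]
    intro n
    filter_upwards [(herg.toMeasurePreserving.iterate n).quasiMeasurePreserving.ae hinv] with θ hθ
    rwa [Function.iterate_succ_apply']
  filter_upwards [hs, hae, hinv'] with θ h1 h2 h3 hw
  obtain ⟨t, ht⟩ := eq_smul_of_wedge_eq_zero (vFull_ne_zero _) hw
  have h4 : Tendsto (fun n => ‖mulVecE (coc (⇑γ) A n θ) (vFull (αu θ))‖) atTop (𝓝 0) := by
    have h5 : Tendsto (fun n => ‖mulVecE (coc (⇑γ) A n θ) (vFull (αs θ))‖) atTop (𝓝 0) :=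
      squeeze_zero' (Eventually.of_forall fun n => norm_nonneg _) (h1 (lam / 2) (by linarith)) hlim
    simpa [ht, mulVecE_smul, norm_smul] using h5.const_mul |t|
  have h6 := (h4.comp hns.tendsto_atTop).mul h2
  have h7 : Tendsto (fun _ : ℕ => (1 : ℝ)) atTop (𝓝 (0 * 0)) := by
    refine h6.congr fun k => ?_
    obtain ⟨t, ht⟩ := exists_coc_unstable_eq_smul (e := fun θ => vFull (αu θ))
      (fun θ => vFull_ne_zero _) h3 (ns k)
    exact norm_coc_mul_norm_coc_invGen hdet (e := fun θ => vFull (αu θ))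
      (fun θ => norm_vFull _) ht
  rw [mul_zero] at h7
  exact one_ne_zero (tendsto_nhds_unique tendsto_const_nhds h7)

/-- An almost sure property holds everywhere on a measurable invariant set of full measure. -/
lemma exists_invariant_full_measure (hγ' : Measurable ⇑γ.symm) (herg : Ergodic ⇑γ m)
    {p : Θ → Prop} (hp : ∀ᵐ θ ∂m, p θ) :
    ∃ S : Set Θ, MeasurableSet S ∧ ⇑γ ⁻¹' S = S ∧ m S = 1 ∧ ∀ θ ∈ S, p θ := by
  obtain ⟨G, hGp, hGm, hG⟩ : ∃ G : Set Θ, (∀ θ ∈ G, p θ) ∧ MeasurableSet G ∧ ∀ᵐ θ ∂m, θ ∈ G := by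
    refine ⟨(toMeasurable m {θ | ¬ p θ})ᶜ, fun θ hθ => ?_, (measurableSet_toMeasurable _ _).compl,
      ?_⟩
    · by_contra h
      exact hθ (subset_toMeasurable m _ h)
    · rw [ae_iff]
      simp only [mem_compl_iff, not_not]
      exact (measure_toMeasurable _).trans (ae_iff.mp hp)
  have hsymm := ergodic_symm hγ' herg
  refine ⟨{θ | ∀ n : ℕ, (⇑γ)^[n] θ ∈ G ∧ (⇑γ.symm)^[n] θ ∈ G}, ?_, ?_, ?_, fun θ hθ =>
    hGp θ (hθ 0).1⟩
  · simp only [ofPred_forall]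
    exact MeasurableSet.iInter fun n =>
      (herg.measurable.iterate n hGm).inter (hγ'.iterate n hGm)
  · ext θ
    simp only [mem_preimage, mem_ofPred_eq]
    constructor
    · intro h n
      refine ⟨?_, ?_⟩
      · rcases n with _ | n
        · have := (h 1).2
          simpa using this
        · exact (h n).1
      · have := (h (n + 1)).2
        rwa [Function.iterate_succ_apply, γ.symm_apply_apply] at this
    · intro h n
      refine ⟨(h (n + 1)).1, ?_⟩
      rcases n with _ | n
      · exact (h 1).1
      · rw [Function.iterate_succ_apply, γ.symm_apply_apply]
        exact (h n).2
  · have h : ∀ᵐ θ ∂m, ∀ n : ℕ, (⇑γ)^[n] θ ∈ G ∧ (⇑γ.symm)^[n] θ ∈ G := by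
      rw [ae_all_iff]
      intro n
      exact ((herg.toMeasurePreserving.iterate n).quasiMeasurePreserving.ae hG).and
        ((hsymm.toMeasurePreserving.iterate n).quasiMeasurePreserving.ae hG)
    exact (measure_congr (eventuallyEq_univ.mpr h)).trans measure_univ

/-- The Oseledets splitting of a bounded unimodular cocycle with positive Lyapunov exponent, on an
invariant set of full measure. -/
lemma exists_splitting (hγ' : Measurable ⇑γ.symm) (herg : Ergodic ⇑γ m)
    (hdet : ∀ θ, (A θ).det = 1) (hAmeas : ∀ i j, Measurable fun θ => A θ i j) {C : ℝ}
    (hC : ∀ θ, opNorm (A θ) ≤ C) {lam : ℝ}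
    (hlam : Tendsto (fun n : ℕ => (∫ θ, Real.log (opNorm (coc ⇑γ A n θ)) ∂m) / n) atTop (𝓝 lam))
    (hpos : 0 < lam) :
    ∃ αu αs : Θ → ℝ, Measurable αu ∧ Measurable αs ∧ (∀ θ, αu θ ∈ Ico (0 : ℝ) (1 / 2)) ∧
      (∀ θ, αs θ ∈ Ico (0 : ℝ) (1 / 2)) ∧ ∃ S : Set Θ, MeasurableSet S ∧ ⇑γ ⁻¹' S = S ∧ m S = 1 ∧
        ∀ θ ∈ S,
          (∀ a < lam, ∀ᶠ n : ℕ in atTop,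
            ‖mulVecE (coc (⇑γ) A n θ) (vFull (αs θ))‖ ≤ Real.exp (-a * n)) ∧
          (∀ a < lam, ∀ᶠ n : ℕ in atTop,
            ‖mulVecE (coc (⇑γ.symm) (invGen γ A) n θ) (vFull (αu θ))‖ ≤ Real.exp (-a * n)) ∧
          wedge (mulVecE (A θ) (vFull (αu θ))) (vFull (αu (γ θ))) = 0 ∧
          wedge (vFull (αu θ)) (vFull (αs θ)) ≠ 0 := by
  obtain ⟨αs, hαs, hαs', hs⟩ := exists_stable_angle herg hdet hAmeas hC hlam hpos
  obtain ⟨αu, hαu, hαu', hu⟩ := exists_unstable_angle hγ' herg hdet hAmeas hC hlam hpos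
  have hinv : ∀ᵐ θ ∂m, wedge (mulVecE (A θ) (vFull (αu θ))) (vFull (αu (γ θ))) = 0 := by
    filter_upwards [hu, herg.quasiMeasurePreserving.ae hu] with θ h1 h2
    exact wedge_mulVecE_unstable_eq_zero hdet hpos h1 h2
  have htr := ae_wedge_ne_zero hγ' herg hdet hAmeas hpos hαu hs hu hinv
  exact ⟨αu, αs, hαu, hαs, hαu', hαs',
    exists_invariant_full_measure hγ' herg (hs.and (hu.and (hinv.and htr)))⟩

end Splitting

section GainFunction

variable {h : ℝ → ℝ}

lemma GoodH.continuousOn (hh : GoodH h) : ContinuousOn h (Ici 0) := hh.1.continuousOn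

lemma GoodH.strictMonoOn (hh : GoodH h) : StrictMonoOn h (Ici 0) := hh.2.1

lemma GoodH.strictConcaveOn (hh : GoodH h) : StrictConcaveOn ℝ (Ici 0) h := hh.2.2.1

lemma GoodH.nonneg (hh : GoodH h) {x : ℝ} (hx : 0 ≤ x) : 0 ≤ h x := hh.2.2.2.2.1 x hx

lemma GoodH.map_zero (hh : GoodH h) : h 0 = 0 := hh.2.2.2.2.2.1

lemma GoodH.pos (hh : GoodH h) {x : ℝ} (hx : 0 < x) : 0 < h x := by
  rw [← hh.map_zero]
  exact hh.strictMonoOn self_mem_Ici hx.le hx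

lemma GoodH.mono (hh : GoodH h) {x y : ℝ} (hx : 0 ≤ x) (hxy : x ≤ y) : h x ≤ h y :=
  hh.strictMonoOn.monotoneOn hx (hx.trans hxy) hxy

lemma GoodH.hasDerivWithinAt (hh : GoodH h) : HasDerivWithinAt h 1 (Ici 0) 0 := by
  rw [← hh.2.2.2.2.2.2]
  exact ((hh.1.differentiableOn (by norm_num)) 0 self_mem_Ici).hasDerivWithinAt

lemma GoodH.tendsto_slope (hh : GoodH h) : Tendsto (slope h 0) (𝓝[>] 0) (𝓝 1) :=
  (hasDerivWithinAt_iff_tendsto_slope' self_notMem_Ioi).mp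
    (hh.hasDerivWithinAt.mono Ioi_subset_Ici_self)

lemma GoodH.mul_lt_mul (hh : GoodH h) {x y : ℝ} (hx : 0 < x) (hxy : x < y) :
    x * h y < y * h x := by
  have hy := hx.trans hxy
  have h1 := hh.strictConcaveOn.2 (show (0 : ℝ) ∈ Ici 0 from self_mem_Ici)
    (show y ∈ Ici 0 from hy.le) hy.ne
    (show 0 < 1 - x / y by rw [sub_pos, div_lt_one hy]; exact hxy)
    (show 0 < x / y by positivity) (by ring)
  simp only [smul_eq_mul, mul_zero, zero_add, hh.map_zero, div_mul_cancel₀ _ hy.ne'] at h1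
  rwa [div_mul_eq_mul_div, div_lt_iff₀ hy, mul_comm (h x)] at h1

lemma GoodH.le_self (hh : GoodH h) {x : ℝ} (hx : 0 ≤ x) : h x ≤ x := by
  rcases hx.eq_or_lt with rfl | hx
  · exact hh.map_zero.le
  have h1 : ∀ᶠ y in 𝓝[>] (0 : ℝ), h x / x ≤ slope h 0 y := by
    filter_upwards [Ioo_mem_nhdsGT hx] with y hy
    rw [slope_def_field, hh.map_zero, sub_zero, sub_zero, div_le_div_iff₀ hx hy.1]
    linarith [hh.mul_lt_mul hy.1 hy.2]
  have h2 := ge_of_tendsto hh.tendsto_slope h1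
  rwa [div_le_one hx] at h2

lemma GoodH.exists_mul_le (hh : GoodH h) {b β : ℝ} (hβ : 0 < β) (hb : b < β) :
    ∃ δ, 0 < δ ∧ ∀ r, 0 ≤ r → r ≤ δ → b * r ≤ h (β * r) := by
  have h1 : ∀ᶠ y in 𝓝[>] (0 : ℝ), b / β < slope h 0 y :=
    hh.tendsto_slope.eventually_const_lt (by rwa [div_lt_one hβ])
  obtain ⟨u, hu, hu'⟩ := mem_nhdsGT_iff_exists_Ioc_subset.mp h1
  refine ⟨u / β, div_pos hu hβ, fun r hr0 hr => ?_⟩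
  rcases hr0.eq_or_lt with rfl | hr0
  · simp [hh.map_zero]
  have h2 : b / β < slope h 0 (β * r) := hu' ⟨by positivity, by rwa [mul_comm, ← le_div_iff₀ hβ]⟩
  rw [slope_def_field, hh.map_zero, sub_zero, sub_zero,
    div_lt_div_iff₀ hβ (by positivity)] at h2
  nlinarith

end GainFunction

lemma exists_dist_lt_of_strictMonoOn {φ : ℝ → ℝ} (hmono : StrictMonoOn φ (Ioi 0))
    (hcont : ContinuousOn φ (Ioi 0)) (M : ℝ) {ε : ℝ} (hε : 0 < ε) :
    ∃ η > 0, ∀ r c, 0 < r → r ≤ M → 0 < c → c ≤ M → |φ r - φ c| < η → |r - c| < ε := by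
  obtain ⟨η, hη, H⟩ : ∃ η > 0, ∀ r ∈ Icc ε M, η ≤ φ r - φ (r - ε / 2) := by
    rcases (Icc ε M).eq_empty_or_nonempty with he | hne
    · exact ⟨1, one_pos, by simp [he]⟩
    have hc : ContinuousOn (fun r => φ r - φ (r - ε / 2)) (Icc ε M) := by
      refine (hcont.mono fun r hr => hε.trans_le hr.1).sub (hcont.comp (by fun_prop) ?_)
      intro r hr
      simp only [mem_Ioi]
      linarith [hr.1]
    obtain ⟨r₀, hr₀, hmin⟩ := isCompact_Icc.exists_isMinOn hne hc
    refine ⟨φ r₀ - φ (r₀ - ε / 2), ?_, fun r hr => hmin hr⟩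
    have := hr₀.1
    exact sub_pos.mpr (hmono (show 0 < r₀ - ε / 2 by linarith) (show 0 < r₀ by linarith)
      (by linarith))
  have key : ∀ r c, r ≤ M → 0 < c → |φ r - φ c| < η → r - c < ε := by
    intro r c hr hc hφ
    by_contra! hrc
    have h1 := H r ⟨by linarith, hr⟩
    have h2 := hmono.monotoneOn (show 0 < c from hc) (show 0 < r - ε / 2 by linarith)
      (by linarith)
    linarith [le_abs_self (φ r - φ c)]
  refine ⟨η, hη, fun r c hr hrM hc hcM hφ => abs_lt.mpr ⟨?_, key r c hrM hc hφ⟩⟩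
  have := key c r hcM hr (by rwa [abs_sub_comm])
  linarith

lemma tendsto_zero_of_add_le {d D e : ℕ → ℝ} (hd : ∀ n, 0 ≤ d n) (hD : ∀ n, 0 ≤ D n)
    (he : ∀ n, 0 ≤ e n) (hsum : Summable e) (h : ∀ n, d (n + 1) + D n ≤ d n + e n) :
    Tendsto D atTop (𝓝 0) := by
  refine (summable_of_sum_range_le (c := d 0 + ∑' n, e n) hD fun n => ?_).tendsto_atTop_zero
  have h1 : d n + ∑ i ∈ Finset.range n, D i ≤ d 0 + ∑ i ∈ Finset.range n, e i := by
    induction n with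
    | zero => simp
    | succ n ih => rw [Finset.sum_range_succ, Finset.sum_range_succ]; linarith [h n]
  linarith [hd n, hsum.sum_le_tsum (Finset.range n) fun i _ => he i]

/-- Two positive bounded orbits driven by the same concave gain function with asymptotically
equal multipliers synchronise. -/
lemma tendsto_sub_of_gain_recursion {h : ℝ → ℝ} (hh : GoodH h) {β : ℝ} (hβ : 0 < β) {M : ℝ}
    {r c x y : ℕ → ℝ} (hr : ∀ n, 0 < r n) (hrM : ∀ n, r n ≤ M) (hc : ∀ n, 0 < c n)
    (hcM : ∀ n, c n ≤ M) (hx : ∀ n, 0 < x n) (hy : ∀ n, 0 < y n)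
    (hrs : ∀ n, r (n + 1) = h (β * r n) * x n) (hcs : ∀ n, c (n + 1) = h (β * c n) * y n)
    (hsum : Summable fun n => |Real.log (x n) - Real.log (y n)|) :
    Tendsto (fun n => r n - c n) atTop (𝓝 0) := by
  have hpos {t : ℝ} (ht : 0 < t) : 0 < h (β * t) := hh.pos (mul_pos hβ ht)
  set φ : ℝ → ℝ := fun t => Real.log t - Real.log (h (β * t)) with hφ
  have hmono : StrictMonoOn φ (Ioi 0) := by
    intro s hs t ht hst
    simp only [mem_Ioi] at hs ht
    have h1 := hh.mul_lt_mul (mul_pos hβ hs) (mul_lt_mul_of_pos_left hst hβ)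
    have h2 : s * h (β * t) < t * h (β * s) := by nlinarith
    have h3 := Real.log_lt_log (mul_pos hs (hpos ht)) h2
    rw [Real.log_mul hs.ne' (hpos ht).ne', Real.log_mul ht.ne' (hpos hs).ne'] at h3
    simp only [hφ]
    linarith
  have hcont : ContinuousOn φ (Ioi 0) := by
    have h1 : ContinuousOn (fun t => h (β * t)) (Ioi 0) :=
      hh.continuousOn.comp (by fun_prop) fun t ht => (mul_pos hβ ht).le
    exact (Real.continuousOn_log.mono fun t ht => (ne_of_gt ht)).sub
      (h1.log fun t ht => (hpos ht).ne')
  have key (s t : ℝ) (hs : 0 < s) (ht : 0 < t) :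
      |Real.log (h (β * s)) - Real.log (h (β * t))| + |φ s - φ t| ≤
        |Real.log s - Real.log t| := by
    wlog hst : s ≤ t generalizing s t
    · have := this t s ht hs (le_of_not_ge hst)
      rwa [abs_sub_comm, abs_sub_comm (φ s), abs_sub_comm (Real.log s)]
    have h1 := Real.log_le_log (hpos hs)
      (hh.mono (mul_pos hβ hs).le (mul_le_mul_of_nonneg_left hst hβ.le))
    have h2 := Real.log_le_log hs hst
    have h3 := hmono.monotoneOn hs ht hst
    rw [abs_of_nonpos (by linarith), abs_of_nonpos (by linarith), abs_of_nonpos (by linarith)]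
    simp only [hφ]
    linarith
  have hlim : Tendsto (fun n => |φ (r n) - φ (c n)|) atTop (𝓝 0) := by
    refine tendsto_zero_of_add_le (d := fun n => |Real.log (r n) - Real.log (c n)|)
      (fun n => abs_nonneg _) (fun n => abs_nonneg _) (fun n => abs_nonneg _) hsum fun n => ?_
    have h1 : Real.log (r (n + 1)) - Real.log (c (n + 1)) =
        (Real.log (h (β * r n)) - Real.log (h (β * c n))) +
          (Real.log (x n) - Real.log (y n)) := by
      rw [hrs, hcs, Real.log_mul (hpos (hr n)).ne' (hx n).ne',
        Real.log_mul (hpos (hc n)).ne' (hy n).ne']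
      ring
    simp only [h1]
    linarith [key _ _ (hr n) (hc n), abs_add_le (Real.log (h (β * r n)) - Real.log (h (β * c n)))
      (Real.log (x n) - Real.log (y n))]
  rw [Metric.tendsto_atTop]
  intro ε hε
  obtain ⟨η, hη, H⟩ := exists_dist_lt_of_strictMonoOn hmono hcont M hε
  obtain ⟨N, hN⟩ := eventually_atTop.mp (hlim.eventually_lt_const hη)
  refine ⟨N, fun n hn => ?_⟩
  rw [Real.dist_eq, sub_zero]
  exact H _ _ (hr n) (hrM n) (hc n) (hcM n) (hN n hn)

lemma abs_log_sub_log_le {C x y : ℝ} (hC : 0 < C) (hx : 1 ≤ C * x) (hy : 1 ≤ C * y) :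
    |Real.log x - Real.log y| ≤ C * |x - y| := by
  have pos {t : ℝ} (ht : 1 ≤ C * t) : 0 < t := by
    by_contra! h
    nlinarith
  wlog hxy : x ≤ y generalizing x y
  · rw [abs_sub_comm, abs_sub_comm x]
    exact this hy hx (le_of_not_ge hxy)
  have h0 := pos hx
  rw [abs_of_nonpos (by linarith [Real.log_le_log h0 hxy]), abs_of_nonpos (by linarith),
    neg_sub, neg_sub, ← Real.log_div (pos hy).ne' h0.ne']
  have h1 := Real.log_le_sub_one_of_pos (div_pos (pos hy) h0)
  have h2 : y / x - 1 ≤ C * (y - x) := by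
    rw [div_sub_one h0.ne', div_le_iff₀ h0]
    nlinarith
  linarith

section FibreDynamics

variable {Θ : Type*} {A : Θ → Matrix (Fin 2) (Fin 2) ℝ} {h : ℝ → ℝ} {β : ℝ}

lemma fibMap_zero (θ : Θ) : fibMap A h β θ 0 = 0 := if_pos rfl

lemma fibMap_of_ne_zero (θ : Θ) {v : R2} (hv : v ≠ 0) :
    fibMap A h β θ v = (h (β * ‖v‖) / ‖v‖) • mulVecE (A θ) v := if_neg hv

lemma mulVecE_neg (M : Matrix (Fin 2) (Fin 2) ℝ) (v : R2) : mulVecE M (-v) = -mulVecE M v := by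
  rw [← neg_one_smul ℝ v, mulVecE_smul, neg_one_smul]

lemma fibMap_neg (θ : Θ) (v : R2) : fibMap A h β θ (-v) = -fibMap A h β θ v := by
  rcases eq_or_ne v 0 with rfl | hv
  · rw [neg_zero, fibMap_zero, neg_zero]
  · rw [fibMap_of_ne_zero θ hv, fibMap_of_ne_zero θ (neg_ne_zero.mpr hv), norm_neg, mulVecE_neg,
      smul_neg]

lemma fibMap_smul_of_nonneg (hh : GoodH h) (θ : Θ) {e : R2} (he : ‖e‖ = 1) {r : ℝ} (hr : 0 ≤ r) :
    fibMap A h β θ (r • e) = h (β * r) • mulVecE (A θ) e := by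
  rcases hr.eq_or_lt with rfl | hr
  · rw [zero_smul, fibMap_zero, mul_zero, hh.map_zero, zero_smul]
  · have he0 : e ≠ 0 := by rw [← norm_ne_zero_iff, he]; exact one_ne_zero
    rw [fibMap_of_ne_zero θ (smul_ne_zero hr.ne' he0), norm_smul, he, mul_one,
      Real.norm_of_nonneg hr.le, mulVecE_smul, smul_smul, div_mul_cancel₀ _ hr.ne']

lemma norm_fibMap_smul (hh : GoodH h) (hβ : 0 < β) (θ : Θ) {e : R2} (he : ‖e‖ = 1) (s : ℝ) :
    ‖fibMap A h β θ (s • e)‖ = h (β * |s|) * ‖mulVecE (A θ) e‖ := by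
  have key (r : ℝ) (hr : 0 ≤ r) :
      ‖fibMap A h β θ (r • e)‖ = h (β * r) * ‖mulVecE (A θ) e‖ := by
    rw [fibMap_smul_of_nonneg hh θ he hr, norm_smul,
      Real.norm_of_nonneg (hh.nonneg (mul_nonneg hβ.le hr))]
  rcases abs_cases s with ⟨h1, h2⟩ | ⟨h1, h2⟩
  · rw [h1, key s h2]
  · rw [h1, ← key (-s) (by linarith), neg_smul, fibMap_neg, norm_neg]

lemma mul_opNorm_le_one (hdet : ∀ θ, (A θ).det = 1) {C : ℝ} (hC : ∀ θ, opNorm (A θ) ≤ C)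
    (hscale : Scaled A h) {x : ℝ} (hx : 0 ≤ x) (θ : Θ) : h x * opNorm (A θ) ≤ 1 := by
  have h1 : opNorm (A θ) ≤ ⨆ θ, opNorm (A θ) :=
    le_ciSup (f := fun θ => opNorm (A θ)) ⟨C, by rintro _ ⟨θ, rfl⟩; exact hC θ⟩ θ
  have h2 : 0 < opNorm (A θ) := zero_lt_one.trans_le (one_le_opNorm (hdet θ))
  calc h x * opNorm (A θ) ≤ (⨆ θ, opNorm (A θ))⁻¹ * opNorm (A θ) :=
        mul_le_mul_of_nonneg_right (hscale x hx) h2.le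
    _ ≤ (opNorm (A θ))⁻¹ * opNorm (A θ) :=
        mul_le_mul_of_nonneg_right (inv_anti₀ h2 h1) h2.le
    _ = 1 := inv_mul_cancel₀ h2.ne'

lemma norm_fibMap_le_one (hh : GoodH h) (hβ : 0 < β) (hdet : ∀ θ, (A θ).det = 1) {C : ℝ}
    (hC : ∀ θ, opNorm (A θ) ≤ C) (hscale : Scaled A h) (θ : Θ) (v : R2) :
    ‖fibMap A h β θ v‖ ≤ 1 := by
  rcases eq_or_ne v 0 with rfl | hv
  · rw [fibMap_zero, norm_zero]; exact zero_le_one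
  have hv' : 0 < ‖v‖ := norm_pos_iff.mpr hv
  have h0 : 0 ≤ h (β * ‖v‖) := hh.nonneg (by positivity)
  rw [fibMap_of_ne_zero θ hv, norm_smul, Real.norm_of_nonneg (by positivity), div_mul_eq_mul_div,
    div_le_one hv']
  calc h (β * ‖v‖) * ‖mulVecE (A θ) v‖ ≤ h (β * ‖v‖) * (opNorm (A θ) * ‖v‖) :=
        mul_le_mul_of_nonneg_left (norm_mulVecE_le _ _) h0
    _ = h (β * ‖v‖) * opNorm (A θ) * ‖v‖ := by ring
    _ ≤ ‖v‖ := mul_le_of_le_one_left hv'.le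
        (mul_opNorm_le_one hdet hC hscale (by positivity) θ)

variable {γ : Θ ≃ Θ}

/-- The fibre component of the iterated skew product. -/
def fibIter (γ : Θ → Θ) (A : Θ → Matrix (Fin 2) (Fin 2) ℝ) (h : ℝ → ℝ) (β : ℝ) (n : ℕ) (θ : Θ)
    (v : R2) : R2 :=
  ((skewProd γ A h β)^[n] (θ, v)).2

lemma skewProd_iterate_fst {γ : Θ → Θ} (n : ℕ) (θ : Θ) (v : R2) :
    ((skewProd γ A h β)^[n] (θ, v)).1 = γ^[n] θ := by
  induction n with
  | zero => rfl
  | succ n ih => rw [Function.iterate_succ_apply', Function.iterate_succ_apply', ← ih]; rfl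

lemma fibIter_zero {γ : Θ → Θ} (θ : Θ) (v : R2) : fibIter γ A h β 0 θ v = v := rfl

lemma fibIter_succ {γ : Θ → Θ} (n : ℕ) (θ : Θ) (v : R2) :
    fibIter γ A h β (n + 1) θ v = fibMap A h β (γ^[n] θ) (fibIter γ A h β n θ v) := by
  unfold fibIter
  rw [Function.iterate_succ_apply', ← skewProd_iterate_fst (A := A) (h := h) (β := β) n θ v]
  rfl

lemma exists_fibIter_eq_smul (hh : GoodH h) (hβ : 0 < β) (hdet : ∀ θ, (A θ).det = 1)
    {γ : Θ → Θ} (n : ℕ) (θ : Θ) {v : R2} (hv : v ≠ 0) :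
    ∃ s : ℝ, 0 < s ∧ s ≤ β ^ n ∧ fibIter γ A h β n θ v = s • mulVecE (coc γ A n θ) v := by
  induction n with
  | zero => exact ⟨1, one_pos, by simp, by simp [fibIter_zero, coc, mulVecE_one]⟩
  | succ n ih =>
    obtain ⟨s, hs0, hs1, hs⟩ := ih
    have hne : fibIter γ A h β n θ v ≠ 0 := by
      rw [hs]; exact smul_ne_zero hs0.ne' (mulVecE_ne_zero (det_coc hdet n θ) hv)
    have hpos : 0 < ‖fibIter γ A h β n θ v‖ := norm_pos_iff.mpr hne
    refine ⟨h (β * ‖fibIter γ A h β n θ v‖) / ‖fibIter γ A h β n θ v‖ * s,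
      mul_pos (div_pos (hh.pos (by positivity)) hpos) hs0, ?_, ?_⟩
    · rw [pow_succ']
      refine mul_le_mul ?_ hs1 hs0.le hβ.le
      rw [div_le_iff₀ hpos]
      exact hh.le_self (by positivity)
    · rw [fibIter_succ, fibMap_of_ne_zero _ hne]
      conv_lhs => rw [hs, mulVecE_smul, smul_smul, ← mulVecE_mul, ← coc_succ, ← hs]

/-- The image of the unit ball under `n` steps of the fibre dynamics ending in the fibre of `θ`. -/
def pullbackBall (γ : Θ ≃ Θ) (A : Θ → Matrix (Fin 2) (Fin 2) ℝ) (h : ℝ → ℝ) (β : ℝ) (n : ℕ)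
    (θ : Θ) : Set R2 :=
  fibIter ⇑γ A h β n ((⇑γ.symm)^[n] θ) '' closedBall 0 1

lemma pullbackBall_zero (θ : Θ) : pullbackBall γ A h β 0 θ = closedBall 0 1 := by
  ext x
  simp [pullbackBall, fibIter_zero]

lemma pullbackBall_succ (n : ℕ) (θ : Θ) :
    pullbackBall γ A h β (n + 1) θ =
      fibMap A h β (γ.symm θ) '' pullbackBall γ A h β n (γ.symm θ) := by
  unfold pullbackBall
  rw [image_image]
  refine image_congr fun v _ => ?_
  rw [fibIter_succ, Function.iterate_succ_apply, iterate_symm_apply]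

lemma mem_attractorFib_iff {θ : Θ} {x : R2} :
    x ∈ attractorFib (⇑γ) A h β θ ↔ ∀ n, x ∈ pullbackBall γ A h β n θ := by
  unfold attractorFib globalAttractor
  simp only [mem_ofPred_eq, mem_iInter]
  refine forall_congr' fun n => ?_
  constructor
  · rintro ⟨⟨θ', v⟩, ⟨_, hv⟩, hp⟩
    have h1 : (⇑γ)^[n] θ' = θ := by
      rw [← skewProd_iterate_fst (A := A) (h := h) (β := β) n θ' v, hp]
    refine ⟨v, hv, ?_⟩
    rw [← h1, symm_iterate_apply, fibIter, hp]
  · rintro ⟨v, hv, hx⟩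
    refine ⟨((⇑γ.symm)^[n] θ, v), ⟨mem_univ _, hv⟩, ?_⟩
    refine Prod.ext ?_ hx
    rw [skewProd_iterate_fst, iterate_symm_apply]

/-- Points of the attractor lie on every line that decays along the backward orbit. -/
lemma wedge_eq_zero_of_mem_attractorFib (hh : GoodH h) (hβ : 0 < β) (hdet : ∀ θ, (A θ).det = 1)
    {lam : ℝ} (hβl : β < Real.exp lam) {θ : Θ} {e x : R2}
    (hu : ∀ a < lam, ∀ᶠ n : ℕ in atTop,
      ‖mulVecE (coc (⇑γ.symm) (invGen γ A) n θ) e‖ ≤ Real.exp (-a * n))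
    (hx : x ∈ attractorFib (⇑γ) A h β θ) : wedge x e = 0 := by
  by_contra hw
  have hlog : Real.log β < lam := (Real.log_lt_iff_lt_exp hβ).mpr hβl
  obtain ⟨a, ha, ha'⟩ := exists_between hlog
  have h1 := eventually_exp_le_norm_of_wedge_ne_zero
    (fun n => det_coc (det_invGen hdet) n θ) hu hw a ha'
  obtain ⟨n, hn, hn1⟩ := (h1.and (eventually_ge_atTop 1)).exists
  obtain ⟨v, hv, hvx⟩ := mem_attractorFib_iff.mp hx n
  have hv0 : v ≠ 0 := by
    rintro rfl
    have h0 (k : ℕ) (θ' : Θ) : fibIter (⇑γ) A h β k θ' 0 = 0 := by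
      induction k with
      | zero => rfl
      | succ k ih => rw [fibIter_succ, ih, fibMap_zero]
    rw [h0] at hvx
    rw [← hvx] at hw
    exact hw (by simp [wedge])
  obtain ⟨s, hs0, hs1, hs⟩ := exists_fibIter_eq_smul (γ := ⇑γ) hh hβ hdet n ((⇑γ.symm)^[n] θ) hv0
  rw [hvx] at hs
  rw [hs, mulVecE_smul, coc_invGen, mulVecE_inv_mulVecE (det_coc hdet n _), norm_smul,
    Real.norm_of_nonneg hs0.le] at hn
  have hv1 : ‖v‖ ≤ 1 := by simpa using hv
  have h2 : s * ‖v‖ ≤ β ^ n := (mul_le_of_le_one_right hs0.le hv1).trans hs1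
  have h3 : β ^ n = Real.exp (Real.log β * n) := by
    rw [mul_comm, Real.exp_nat_mul, Real.exp_log hβ]
  rw [h3] at h2
  have h4 := Real.exp_le_exp.mp (hn.trans h2)
  have h5 : (1 : ℝ) ≤ n := by exact_mod_cast hn1
  nlinarith

/-- The half-length of the segment that `n` steps of the dynamics cut out of the unit ball along
the line field `e`. -/
def radiusIter (γ : Θ ≃ Θ) (A : Θ → Matrix (Fin 2) (Fin 2) ℝ) (h : ℝ → ℝ) (β : ℝ) (e : Θ → R2) :
    ℕ → Θ → ℝ
  | 0, _ => 1
  | n + 1, θ =>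
    h (β * radiusIter γ A h β e n (γ.symm θ)) * ‖mulVecE (A (γ.symm θ)) (e (γ.symm θ))‖

variable {e : Θ → R2}

lemma radiusIter_nonneg (hh : GoodH h) (hβ : 0 < β) (n : ℕ) (θ : Θ) :
    0 ≤ radiusIter γ A h β e n θ := by
  induction n generalizing θ with
  | zero => exact zero_le_one
  | succ n ih => exact mul_nonneg (hh.nonneg (mul_nonneg hβ.le (ih _))) (norm_nonneg _)

lemma radiusIter_antitone (hh : GoodH h) (hβ : 0 < β) (hdet : ∀ θ, (A θ).det = 1) {C : ℝ}
    (hC : ∀ θ, opNorm (A θ) ≤ C) (hscale : Scaled A h) (he : ∀ θ, ‖e θ‖ = 1) (θ : Θ) :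
    Antitone fun n => radiusIter γ A h β e n θ := by
  refine antitone_nat_of_succ_le fun n => ?_
  induction n generalizing θ with
  | zero =>
    have h1 := norm_fibMap_le_one hh hβ hdet hC hscale (γ.symm θ) ((1 : ℝ) • e (γ.symm θ))
    rw [norm_fibMap_smul hh hβ _ (he _), abs_one] at h1
    exact h1
  | succ n ih =>
    refine mul_le_mul_of_nonneg_right (hh.mono ?_ ?_) (norm_nonneg _)
    · exact mul_nonneg hβ.le (radiusIter_nonneg hh hβ _ _)
    · exact mul_le_mul_of_nonneg_left (ih _) hβ.le

/-- Along an invariant line field the image of the unit ball is the segment of half-length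
`radiusIter`. -/
lemma smul_mem_pullbackBall_iff (hh : GoodH h) (hβ : 0 < β) (hdet : ∀ θ, (A θ).det = 1)
    (he : ∀ θ, ‖e θ‖ = 1) {S : Set Θ} (hS : ∀ θ ∈ S, γ.symm θ ∈ S)
    (hinv : ∀ θ ∈ S, wedge (mulVecE (A θ) (e θ)) (e (γ θ)) = 0) (n : ℕ) {θ : Θ} (hθ : θ ∈ S)
    (s : ℝ) : s • e θ ∈ pullbackBall γ A h β n θ ↔ |s| ≤ radiusIter γ A h β e n θ := by
  have he0 (θ : Θ) : e θ ≠ 0 := by rw [← norm_ne_zero_iff, he]; exact one_ne_zero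
  induction n generalizing θ s with
  | zero => simp [pullbackBall_zero, norm_smul, he, radiusIter]
  | succ n ih =>
    have hθ' := hS θ hθ
    have hw := hinv _ hθ'
    rw [γ.apply_symm_apply] at hw
    set θ' := γ.symm θ with hθ'def
    obtain ⟨τ, hτ⟩ := eq_smul_of_wedge_eq_zero (he0 θ) hw
    have hτ0 : τ ≠ 0 := by
      rintro rfl
      exact mulVecE_ne_zero (hdet θ') (he0 θ') (by rw [hτ, zero_smul])
    have hnorm : ‖mulVecE (A θ') (e θ')‖ = |τ| := by
      rw [hτ, norm_smul, he, mul_one, Real.norm_eq_abs]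
    have hR0 := radiusIter_nonneg (γ := γ) (A := A) (e := e) hh hβ n θ'
    rw [pullbackBall_succ, radiusIter, ← hθ'def]
    constructor
    · rintro ⟨x, hx, hxs⟩
      obtain ⟨t, rfl⟩ : ∃ t : ℝ, x = t • e θ' := by
        rcases eq_or_ne x 0 with rfl | hx0
        · exact ⟨0, by simp⟩
        refine eq_smul_of_wedge_eq_zero (he0 θ') ?_
        rw [← wedge_mulVecE (hdet θ'), hτ, wedge_smul_right]
        have hk : h (β * ‖x‖) / ‖x‖ ≠ 0 := by
          have : 0 < ‖x‖ := norm_pos_iff.mpr hx0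
          exact (div_pos (hh.pos (by positivity)) this).ne'
        have h1 := congrArg (fun y => wedge y (e θ)) hxs
        simp only [fibMap_of_ne_zero θ' hx0, wedge_smul_left] at h1
        have h2 : wedge (e θ) (e θ) = 0 := by unfold wedge; ring
        rw [h2, mul_zero] at h1
        rw [(mul_eq_zero.mp h1).resolve_left hk, mul_zero]
      have ht := (ih hθ' t).mp hx
      have h1 := norm_fibMap_smul (A := A) hh hβ θ' (he θ') t
      rw [hxs, norm_smul, he, mul_one, Real.norm_eq_abs] at h1
      rw [h1]
      exact mul_le_mul_of_nonneg_right (hh.mono (by positivity)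
        (mul_le_mul_of_nonneg_left ht hβ.le)) (norm_nonneg _)
    · intro hs
      obtain ⟨ρ, hρ, hρs⟩ : ∃ ρ ∈ Icc 0 (radiusIter γ A h β e n θ'),
          h (β * ρ) * ‖mulVecE (A θ') (e θ')‖ = |s| := by
        have hcont : ContinuousOn (fun ρ => h (β * ρ) * ‖mulVecE (A θ') (e θ')‖)
            (Icc 0 (radiusIter γ A h β e n θ')) :=
          (hh.continuousOn.comp (by fun_prop) fun ρ hρ => mul_nonneg hβ.le hρ.1).mul
            continuousOn_const
        have h0 : |s| ∈ Icc (h (β * 0) * ‖mulVecE (A θ') (e θ')‖)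
            (h (β * radiusIter γ A h β e n θ') * ‖mulVecE (A θ') (e θ')‖) := by
          rw [mul_zero, hh.map_zero, zero_mul]
          exact ⟨abs_nonneg s, hs⟩
        exact intermediate_value_Icc hR0 hcont h0
      have himg : fibMap A h β θ' (ρ • e θ') = (h (β * ρ) * τ) • e θ := by
        rw [fibMap_smul_of_nonneg hh θ' (he θ') hρ.1, hτ, smul_smul]
      have habs : |s| = |h (β * ρ) * τ| := by
        rw [← hρs, hnorm, abs_mul, abs_of_nonneg (hh.nonneg (mul_nonneg hβ.le hρ.1))]
      rcases abs_eq_abs.mp habs with h1 | h1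
      · refine ⟨ρ • e θ', (ih hθ' ρ).mpr ?_, by rw [himg, h1]⟩
        rw [abs_of_nonneg hρ.1]; exact hρ.2
      · refine ⟨(-ρ) • e θ', (ih hθ' (-ρ)).mpr ?_, ?_⟩
        · rw [abs_neg, abs_of_nonneg hρ.1]; exact hρ.2
        · rw [neg_smul, fibMap_neg, himg, h1, neg_smul]

end FibreDynamics

section Attraction

variable {Θ : Type*} {γ : Θ ≃ Θ} {A : Θ → Matrix (Fin 2) (Fin 2) ℝ} {h : ℝ → ℝ} {β : ℝ}
  {e : Θ → R2}

lemma one_le_mul_norm_mulVecE (hdet : ∀ θ, (A θ).det = 1) {C : ℝ} (hC : ∀ θ, opNorm (A θ) ≤ C)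
    (θ : Θ) {v : R2} (hv : ‖v‖ = 1) : 1 ≤ C * ‖mulVecE (A θ) v‖ := by
  rw [← hv]
  exact (norm_le_opNorm_mul_norm_mulVecE (hdet θ) v).trans
    (mul_le_mul_of_nonneg_right (hC θ) (norm_nonneg _))

lemma norm_coc_invGen_succ_mul (hdet : ∀ θ, (A θ).det = 1) (he : ∀ θ, ‖e θ‖ = 1) {θ : Θ}
    (hw : wedge (mulVecE (A (γ.symm θ)) (e (γ.symm θ))) (e θ) = 0) (n : ℕ) :
    ‖mulVecE (coc (⇑γ.symm) (invGen γ A) (n + 1) θ) (e θ)‖ *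
        ‖mulVecE (A (γ.symm θ)) (e (γ.symm θ))‖ =
      ‖mulVecE (coc (⇑γ.symm) (invGen γ A) n (γ.symm θ)) (e (γ.symm θ))‖ := by
  obtain ⟨τ, hτ⟩ := eq_smul_of_wedge_eq_zero
    (by rw [← norm_ne_zero_iff, he]; exact one_ne_zero) hw
  have h1 := mulVecE_coc_invGen_succ_apply (γ := γ) hdet n (γ.symm θ) (e (γ.symm θ))
  rw [γ.apply_symm_apply, hτ, mulVecE_smul] at h1
  rw [← h1, hτ, norm_smul, norm_smul, he]
  ring

/-- If the backward contraction along `e` beats the weakest expansion of the gain function, the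
radii stay bounded away from zero. -/
lemma exists_pos_le_radiusIter (hh : GoodH h) (hβ : 0 < β) (hdet : ∀ θ, (A θ).det = 1) {C : ℝ}
    (hC : ∀ θ, opNorm (A θ) ≤ C) (he : ∀ θ, ‖e θ‖ = 1) {S : Set Θ}
    (hS : ∀ θ ∈ S, γ.symm θ ∈ S)
    (hinv : ∀ θ ∈ S, wedge (mulVecE (A θ) (e θ)) (e (γ θ)) = 0) {lam : ℝ}
    (hβl : Real.exp (-lam) < β) {θ : Θ} (hθ : θ ∈ S)
    (hu : ∀ a < lam, ∀ᶠ n : ℕ in atTop,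
      ‖mulVecE (coc (⇑γ.symm) (invGen γ A) n θ) (e θ)‖ ≤ Real.exp (-a * n)) :
    ∃ κ > 0, ∀ n, κ ≤ radiusIter γ A h β e n θ := by
  obtain ⟨b, hb1, hb2⟩ := exists_between hβl
  have hb0 : 0 < b := (Real.exp_pos _).trans hb1
  obtain ⟨δ, hδ, hδb⟩ := hh.exists_mul_le hβ hb2
  have hC0 : 0 < C := zero_lt_one.trans_le ((one_le_opNorm (hdet θ)).trans (hC θ))
  set N : ℕ → Θ → ℝ := fun n θ => ‖mulVecE (coc (⇑γ.symm) (invGen γ A) n θ) (e θ)‖ with hN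
  have hN0 (θ : Θ) : N 0 θ = 1 := by simp [hN, coc, mulVecE_one, he]
  have hNpos (n : ℕ) (θ : Θ) : 0 < N n θ := norm_pos_iff.mpr
    (mulVecE_ne_zero (det_coc (det_invGen hdet) n θ)
      (by rw [← norm_ne_zero_iff, he]; exact one_ne_zero))
  set κ := min 1 (h (β * δ) / C) with hκ
  have hhδ : 0 < h (β * δ) := hh.pos (mul_pos hβ hδ)
  have hκ0 : 0 < κ := lt_min one_pos (div_pos hhδ hC0)
  have main (n : ℕ) : ∀ θ ∈ S, ∃ j, κ * b ^ j ≤ radiusIter γ A h β e n θ * N j θ := by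
    induction n with
    | zero =>
      intro θ _
      exact ⟨0, by rw [hN0, pow_zero, mul_one, mul_one]; exact min_le_left _ _⟩
    | succ n ih =>
      intro θ hθ
      have hw := hinv _ (hS θ hθ)
      rw [γ.apply_symm_apply] at hw
      have hΩ := one_le_mul_norm_mulVecE hdet hC (γ.symm θ) (he (γ.symm θ))
      have hR0 := radiusIter_nonneg (γ := γ) (A := A) (e := e) hh hβ n (γ.symm θ)
      rcases le_or_gt (radiusIter γ A h β e n (γ.symm θ)) δ with hle | hgt
      · obtain ⟨j, hj⟩ := ih _ (hS θ hθ)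
        refine ⟨j + 1, ?_⟩
        rw [radiusIter, mul_assoc, mul_comm _ (N (j + 1) θ),
          norm_coc_invGen_succ_mul hdet he hw j]
        calc κ * b ^ (j + 1) = b * (κ * b ^ j) := by ring
          _ ≤ b * (radiusIter γ A h β e n (γ.symm θ) * N j (γ.symm θ)) :=
            mul_le_mul_of_nonneg_left hj hb0.le
          _ = b * radiusIter γ A h β e n (γ.symm θ) * N j (γ.symm θ) := by ring
          _ ≤ _ := mul_le_mul_of_nonneg_right (hδb _ hR0 hle) (hNpos _ _).le
      · refine ⟨0, ?_⟩
        rw [hN0, pow_zero, mul_one, mul_one, radiusIter]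
        refine (min_le_right _ _).trans ?_
        rw [div_le_iff₀ hC0]
        have h1 : h (β * δ) ≤ h (β * radiusIter γ A h β e n (γ.symm θ)) :=
          hh.mono (by positivity) (mul_le_mul_of_nonneg_left hgt.le hβ.le)
        calc h (β * δ) ≤ h (β * radiusIter γ A h β e n (γ.symm θ)) * 1 := by rwa [mul_one]
          _ ≤ h (β * radiusIter γ A h β e n (γ.symm θ)) *
              (C * ‖mulVecE (A (γ.symm θ)) (e (γ.symm θ))‖) :=
            mul_le_mul_of_nonneg_left hΩ (hhδ.le.trans h1)
          _ = _ := by ring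
  have hbd : BddAbove (range fun j => N j θ / b ^ j) := by
    refine Filter.IsBoundedUnder.bddAbove_range ⟨1, ?_⟩
    rw [eventually_map]
    filter_upwards [hu (-Real.log b) (by
      have := (Real.lt_log_iff_exp_lt hb0).mpr hb1
      linarith)] with j hj
    rw [div_le_one (by positivity)]
    rwa [neg_neg, mul_comm, Real.exp_nat_mul, Real.exp_log hb0] at hj
  obtain ⟨K, hK⟩ := hbd
  have hK' (j : ℕ) : N j θ ≤ K * b ^ j := by
    rw [← div_le_iff₀ (by positivity)]
    exact hK ⟨j, rfl⟩
  have hK0 : 0 < K := by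
    have := hK' 0
    rw [hN0, pow_zero, mul_one] at this
    linarith
  refine ⟨κ / K, div_pos hκ0 hK0, fun n => ?_⟩
  obtain ⟨j, hj⟩ := main n θ hθ
  have h1 : κ * b ^ j ≤ radiusIter γ A h β e n θ * (K * b ^ j) :=
    hj.trans (mul_le_mul_of_nonneg_left (hK' j) (radiusIter_nonneg hh hβ n θ))
  rw [div_le_iff₀ hK0]
  rw [← mul_assoc] at h1
  exact le_of_mul_le_mul_right h1 (by positivity)

/-- The half-length of the attractor segment. -/
def segmentRadius (γ : Θ ≃ Θ) (A : Θ → Matrix (Fin 2) (Fin 2) ℝ) (h : ℝ → ℝ) (β : ℝ)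
    (e : Θ → R2) (θ : Θ) : ℝ :=
  ⨅ n, radiusIter γ A h β e n θ

lemma bddBelow_radiusIter (hh : GoodH h) (hβ : 0 < β) (θ : Θ) :
    BddBelow (range fun n => radiusIter γ A h β e n θ) :=
  ⟨0, by rintro _ ⟨n, rfl⟩; exact radiusIter_nonneg hh hβ n θ⟩

lemma segmentRadius_le_one (hh : GoodH h) (hβ : 0 < β) (θ : Θ) :
    segmentRadius γ A h β e θ ≤ 1 :=
  ciInf_le (bddBelow_radiusIter hh hβ θ) 0

lemma segmentRadius_apply (hh : GoodH h) (hβ : 0 < β) (hdet : ∀ θ, (A θ).det = 1) {C : ℝ}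
    (hC : ∀ θ, opNorm (A θ) ≤ C) (hscale : Scaled A h) (he : ∀ θ, ‖e θ‖ = 1) (θ : Θ) :
    segmentRadius γ A h β e (γ θ) =
      h (β * segmentRadius γ A h β e θ) * ‖mulVecE (A θ) (e θ)‖ := by
  have hlim (θ : Θ) : Tendsto (fun n => radiusIter γ A h β e n θ) atTop
      (𝓝 (segmentRadius γ A h β e θ)) :=
    tendsto_atTop_ciInf (radiusIter_antitone hh hβ hdet hC hscale he θ)
      (bddBelow_radiusIter hh hβ θ)
  have h0 : 0 ≤ segmentRadius γ A h β e θ := le_ciInf fun n => radiusIter_nonneg hh hβ n θ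
  have h1 := (hlim (γ θ)).comp (tendsto_add_atTop_nat 1)
  have h2 : Tendsto (fun n => h (β * radiusIter γ A h β e n θ)) atTop
      (𝓝 (h (β * segmentRadius γ A h β e θ))) := by
    have h3 : ContinuousWithinAt h (Ici 0) (β * segmentRadius γ A h β e θ) :=
      hh.continuousOn _ (mul_nonneg hβ.le h0)
    refine h3.tendsto.comp (tendsto_nhdsWithin_iff.mpr ⟨(hlim θ).const_mul β, ?_⟩)
    exact Eventually.of_forall fun n => mul_nonneg hβ.le (radiusIter_nonneg hh hβ n θ)
  refine tendsto_nhds_unique h1 ((h2.mul_const _).congr fun n => ?_)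
  simp only [Function.comp_apply, radiusIter, γ.symm_apply_apply]

lemma attractorFib_eq_segment (hh : GoodH h) (hβ : 0 < β) (hdet : ∀ θ, (A θ).det = 1)
    (he : ∀ θ, ‖e θ‖ = 1) {S : Set Θ} (hS : ∀ θ ∈ S, γ.symm θ ∈ S)
    (hinv : ∀ θ ∈ S, wedge (mulVecE (A θ) (e θ)) (e (γ θ)) = 0) {lam : ℝ}
    (hβl : β < Real.exp lam) {θ : Θ} (hθ : θ ∈ S)
    (hu : ∀ a < lam, ∀ᶠ n : ℕ in atTop,
      ‖mulVecE (coc (⇑γ.symm) (invGen γ A) n θ) (e θ)‖ ≤ Real.exp (-a * n)) :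
    attractorFib (⇑γ) A h β θ =
      {x : R2 | ∃ s : ℝ, |s| ≤ segmentRadius γ A h β e θ ∧ x = s • e θ} := by
  have key (s : ℝ) : s • e θ ∈ attractorFib (⇑γ) A h β θ ↔
      |s| ≤ segmentRadius γ A h β e θ := by
    rw [mem_attractorFib_iff, segmentRadius, le_ciInf_iff (bddBelow_radiusIter hh hβ θ)]
    exact forall_congr' fun n => smul_mem_pullbackBall_iff hh hβ hdet he hS hinv n hθ s
  ext x
  constructor
  · intro hx
    obtain ⟨s, rfl⟩ := eq_smul_of_wedge_eq_zero
      (by rw [← norm_ne_zero_iff, he]; exact one_ne_zero)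
      (wedge_eq_zero_of_mem_attractorFib hh hβ hdet hβl hu hx)
    exact ⟨s, (key s).mp hx, rfl⟩
  · rintro ⟨s, hs, rfl⟩
    exact (key s).mpr hs

/-- The endpoints of the attractor segments attract every vector off the stable line. -/
lemma tendsto_infDist_fibIter (hh : GoodH h) (hβ : 0 < β) (hdet : ∀ θ, (A θ).det = 1) {C : ℝ}
    (hC : ∀ θ, opNorm (A θ) ≤ C) (hscale : Scaled A h) (he : ∀ θ, ‖e θ‖ = 1) {lam : ℝ}
    (hpos : 0 < lam) {θ : Θ}
    (hinv : ∀ n : ℕ, wedge (mulVecE (A ((⇑γ)^[n] θ)) (e ((⇑γ)^[n] θ))) (e ((⇑γ)^[n + 1] θ)) = 0)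
    (hrad : ∀ n : ℕ, 0 < segmentRadius γ A h β e ((⇑γ)^[n] θ)) {s v : R2}
    (hs : ∀ a < lam, ∀ᶠ n : ℕ in atTop, ‖mulVecE (coc (⇑γ) A n θ) s‖ ≤ Real.exp (-a * n))
    (hes : wedge (e θ) s ≠ 0) (hvs : wedge v s ≠ 0) :
    Tendsto (fun n : ℕ => infDist (fibIter (⇑γ) A h β n θ v)
      {segmentRadius γ A h β e ((⇑γ)^[n] θ) • e ((⇑γ)^[n] θ),
        -(segmentRadius γ A h β e ((⇑γ)^[n] θ) • e ((⇑γ)^[n] θ))}) atTop (𝓝 0) := by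
  have he0 (θ : Θ) : e θ ≠ 0 := by rw [← norm_ne_zero_iff, he]; exact one_ne_zero
  have hC0 : 0 < C := zero_lt_one.trans_le ((one_le_opNorm (hdet θ)).trans (hC θ))
  have hv0 : v ≠ 0 := by
    rintro rfl
    exact hvs (by simp [wedge])
  set E : ℕ → R2 := fun n => e ((⇑γ)^[n] θ) with hE
  have hE1 (n : ℕ) : ‖E n‖ = 1 := he _
  set c : ℕ → ℝ := fun n => segmentRadius γ A h β e ((⇑γ)^[n] θ) with hc
  set V : ℕ → R2 := fun n => mulVecE (coc (⇑γ) A n θ) v with hV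
  have hVpos (n : ℕ) : 0 < ‖V n‖ :=
    norm_pos_iff.mpr (mulVecE_ne_zero (det_coc hdet n θ) hv0)
  set w : ℕ → R2 := fun n => ‖V n‖⁻¹ • V n with hw
  have hw1 (n : ℕ) : ‖w n‖ = 1 := by
    rw [hw]
    simp only [norm_smul, norm_inv, norm_norm]
    exact inv_mul_cancel₀ (hVpos n).ne'
  set r : ℕ → ℝ := fun n => ‖fibIter (⇑γ) A h β n θ v‖ with hr
  have hfib (n : ℕ) : 0 < r n ∧ fibIter (⇑γ) A h β n θ v = r n • w n := by
    obtain ⟨t, ht0, _, ht⟩ := exists_fibIter_eq_smul (γ := ⇑γ) hh hβ hdet n θ hv0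
    have h1 : r n = t * ‖V n‖ := by
      simp only [hr, ht, norm_smul, Real.norm_of_nonneg ht0.le, hV]
    refine ⟨by rw [h1]; exact mul_pos ht0 (hVpos n), ?_⟩
    rw [h1, hw, smul_smul, mul_assoc, mul_inv_cancel₀ (hVpos n).ne', mul_one, ht]
  choose t ht using fun n => exists_coc_unstable_eq_smul (e := e) he0 hinv n
  have hwedge (n : ℕ) : |wedge (w n) (E n)| * (‖V n‖ * |t n|) = |wedge v (e θ)| := by
    rw [← wedge_mulVecE (det_coc hdet n θ) v (e θ), ht, wedge_smul_right, abs_mul, hw]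
    simp only [wedge_smul_left, abs_mul, abs_inv, abs_norm]
    have := (hVpos n).ne'
    field_simp
    exact mul_comm _ _
  have hdecay : ∀ᶠ n : ℕ in atTop,
      |wedge (w n) (E n)| ≤ |wedge v (e θ)| * Real.exp (-lam) ^ n := by
    have hM := fun n => det_coc (γ := ⇑γ) hdet n θ
    filter_upwards [eventually_exp_le_norm_of_wedge_ne_zero hM hs hvs (lam / 2) (by linarith),
      eventually_exp_le_norm_of_wedge_ne_zero hM hs hes (lam / 2) (by linarith)] with n h1 h2
    rw [ht, norm_smul, he, mul_one, Real.norm_eq_abs] at h2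
    have h3 : Real.exp (lam / 2 * n) * Real.exp (lam / 2 * n) ≤ ‖V n‖ * |t n| :=
      mul_le_mul h1 h2 (Real.exp_pos _).le (norm_nonneg _)
    have h4 : Real.exp (lam / 2 * n) * Real.exp (lam / 2 * n) * Real.exp (-lam) ^ n = 1 := by
      rw [← Real.exp_nat_mul, ← Real.exp_add, ← Real.exp_add, Real.exp_eq_one_iff]
      ring
    calc |wedge (w n) (E n)| = |wedge (w n) (E n)| *
          (Real.exp (lam / 2 * n) * Real.exp (lam / 2 * n)) * Real.exp (-lam) ^ n := by
          rw [mul_assoc, h4, mul_one]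
      _ ≤ |wedge (w n) (E n)| * (‖V n‖ * |t n|) * Real.exp (-lam) ^ n :=
          mul_le_mul_of_nonneg_right (mul_le_mul_of_nonneg_left h3 (abs_nonneg _))
            (by positivity)
      _ = _ := by rw [hwedge]
  have hexp : Real.exp (-lam) < 1 := by rw [Real.exp_lt_one_iff]; linarith
  have hwsum : Summable fun n => |wedge (w n) (E n)| := by
    refine summable_of_isBigO_nat
      (summable_geometric_of_lt_one (Real.exp_pos (-lam)).le hexp) ?_
    refine Asymptotics.IsBigO.of_bound |wedge v (e θ)| ?_
    filter_upwards [hdecay] with n hn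
    rwa [Real.norm_of_nonneg (abs_nonneg _), Real.norm_of_nonneg (by positivity)]
  choose σ hσ1 hσ using fun n => exists_sign_norm_sub_le (hw1 n) (hE1 n)
  have hσabs (n : ℕ) : |σ n| = 1 := by rcases hσ1 n with h | h <;> simp [h]
  have hrec (n : ℕ) : r (n + 1) = h (β * r n) * ‖mulVecE (A ((⇑γ)^[n] θ)) (w n)‖ := by
    have h1 := norm_fibMap_smul (A := A) hh hβ ((⇑γ)^[n] θ) (hw1 n) (r n)
    rw [← (hfib n).2, ← fibIter_succ, abs_of_pos (hfib n).1] at h1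
    exact h1
  have hcrec (n : ℕ) : c (n + 1) = h (β * c n) * ‖mulVecE (A ((⇑γ)^[n] θ)) (E n)‖ := by
    simp only [hc, Function.iterate_succ_apply']
    exact segmentRadius_apply hh hβ hdet hC hscale he _
  have hlogsum : Summable fun n => |Real.log ‖mulVecE (A ((⇑γ)^[n] θ)) (w n)‖ -
      Real.log ‖mulVecE (A ((⇑γ)^[n] θ)) (E n)‖| := by
    refine Summable.of_nonneg_of_le (fun n => abs_nonneg _) (fun n => ?_)
      (hwsum.mul_left (C * (C * 2)))
    refine (abs_log_sub_log_le hC0 (one_le_mul_norm_mulVecE hdet hC _ (hw1 n))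
      (one_le_mul_norm_mulVecE hdet hC _ (hE1 n))).trans ?_
    rw [mul_assoc, mul_assoc]
    refine mul_le_mul_of_nonneg_left ?_ hC0.le
    have h1 : ‖mulVecE (A ((⇑γ)^[n] θ)) (E n)‖ = ‖mulVecE (A ((⇑γ)^[n] θ)) (σ n • E n)‖ := by
      rw [mulVecE_smul, norm_smul, Real.norm_eq_abs, hσabs, one_mul]
    rw [h1]
    calc _ ≤ ‖mulVecE (A ((⇑γ)^[n] θ)) (w n) - mulVecE (A ((⇑γ)^[n] θ)) (σ n • E n)‖ :=
          abs_norm_sub_norm_le _ _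
      _ ≤ C * ‖w n - σ n • E n‖ := by
          rw [← mulVecE_sub]
          exact (norm_mulVecE_le _ _).trans (mul_le_mul_of_nonneg_right (hC _) (norm_nonneg _))
      _ ≤ C * (2 * |wedge (w n) (E n)|) := mul_le_mul_of_nonneg_left (hσ n) hC0.le
  have hrM (n : ℕ) : r n ≤ max 1 ‖v‖ := by
    rcases n with _ | n
    · exact le_max_right _ _
    · refine le_max_of_le_left ?_
      simp only [hr, fibIter_succ]
      exact norm_fibMap_le_one hh hβ hdet hC hscale _ _
  have hpos' (n : ℕ) {u : R2} (hu : ‖u‖ = 1) : 0 < ‖mulVecE (A ((⇑γ)^[n] θ)) u‖ :=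
    norm_pos_iff.mpr (mulVecE_ne_zero (hdet _)
      (by rw [← norm_ne_zero_iff, hu]; exact one_ne_zero))
  have hdiff := tendsto_sub_of_gain_recursion hh hβ (fun n => (hfib n).1) hrM hrad
    (fun n => (segmentRadius_le_one hh hβ _).trans (le_max_left _ _))
    (fun n => hpos' n (hw1 n)) (fun n => hpos' n (hE1 n)) hrec hcrec hlogsum
  have hbound : Tendsto (fun n => |r n - c n| + 2 * |wedge (w n) (E n)|) atTop (𝓝 0) := by
    simpa using hdiff.abs.add (hwsum.tendsto_atTop_zero.const_mul 2)
  refine squeeze_zero (fun n => infDist_nonneg) (fun n => ?_) hbound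
  have hmem : (c n * σ n) • E n ∈ ({c n • E n, -(c n • E n)} : Set R2) := by
    rcases hσ1 n with h | h <;> simp [h]
  refine (infDist_le_dist_of_mem hmem).trans ?_
  rw [dist_eq_norm, (hfib n).2]
  have hsplit : r n • w n - (c n * σ n) • E n = (r n - c n) • w n + c n • (w n - σ n • E n) := by
    module
  rw [hsplit]
  refine (norm_add_le _ _).trans (add_le_add ?_ ?_)
  · rw [norm_smul, hw1, mul_one, Real.norm_eq_abs]
  · rw [norm_smul, Real.norm_of_nonneg (hrad n).le]
    exact (mul_le_of_le_one_left (norm_nonneg _) (segmentRadius_le_one hh hβ _)).trans (hσ n)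

end Attraction

/-- If `λ_m(A) > 0`, there are a γ-invariant full-measure set `Θ₀` and
measurable `α_u, α_s : Θ → [0,1/2)` (independent of β) such that for every
`β ∈ (β₁^m, β₂^m)` and `θ ∈ Θ₀`, the attractor fibre is the segment
`{r·v(α_u(θ)) : |r| ≤ c_β(θ)}` with `c_β(θ) > 0`, and its endpoint pair is a random
two-point forward attractor attracting all `v ∉ ℝ·v(α_s(θ))`. -/
theorem stmt4 {Θ : Type*} [MeasurableSpace Θ]
    (γ : Θ ≃ Θ) (hγ : Measurable ⇑γ) (hγ' : Measurable ⇑γ.symm)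
    (m : Measure Θ) [IsProbabilityMeasure m] (herg : Ergodic ⇑γ m)
    (A : Θ → Matrix (Fin 2) (Fin 2) ℝ) (hdet : ∀ θ, (A θ).det = 1)
    (hAmeas : ∀ i j, Measurable fun θ => A θ i j)
    (hAbdd : ∃ C : ℝ, ∀ θ, opNorm (A θ) ≤ C)
    (h : ℝ → ℝ) (hh : GoodH h) (hscale : Scaled A h)
    (lam : ℝ)
    (hlam : Filter.Tendsto
      (fun n : ℕ => (∫ θ, Real.log (opNorm (coc ⇑γ A n θ)) ∂m) / n)
      Filter.atTop (𝓝 lam))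
    (hpos : 0 < lam) :
    ∃ Θ₀ : Set Θ, MeasurableSet Θ₀ ∧ ⇑γ ⁻¹' Θ₀ = Θ₀ ∧ m Θ₀ = 1 ∧
      ∃ αu αs : Θ → ℝ, Measurable αu ∧ Measurable αs ∧
        (∀ θ ∈ Θ₀, αu θ ∈ Set.Ico (0 : ℝ) (1 / 2) ∧ αs θ ∈ Set.Ico (0 : ℝ) (1 / 2)) ∧
        ∀ β : ℝ, Real.exp (-lam) < β → β < Real.exp lam →
          ∃ c : Θ → ℝ, ∀ θ ∈ Θ₀,
            0 < c θ ∧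
            attractorFib ⇑γ A h β θ =
              {x : R2 | ∃ s : ℝ, |s| ≤ c θ ∧ x = s • vFull (αu θ)} ∧
            ∀ v : R2, (¬ ∃ t : ℝ, v = t • vFull (αs θ)) →
              Filter.Tendsto (fun n : ℕ =>
                  Metric.infDist ((skewProd ⇑γ A h β)^[n] (θ, v)).2
                    ({c ((⇑γ)^[n] θ) • vFull (αu ((⇑γ)^[n] θ)),
                      -(c ((⇑γ)^[n] θ) • vFull (αu ((⇑γ)^[n] θ)))} : Set R2))
                Filter.atTop (𝓝 0) := by
  obtain ⟨C, hC⟩ := hAbdd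
  obtain ⟨αu, αs, hαu, hαs, hαu', hαs', S, hSm, hSinv, hS1, hS⟩ :=
    exists_splitting hγ' herg hdet hAmeas hC hlam hpos
  refine ⟨S, hSm, hSinv, hS1, αu, αs, hαu, hαs, fun θ _ => ⟨hαu' θ, hαs' θ⟩,
    fun β hβ1 hβ2 => ⟨segmentRadius γ A h β fun θ => vFull (αu θ), fun θ hθ => ?_⟩⟩
  have hβ : 0 < β := (Real.exp_pos _).trans hβ1
  have hfwd (θ : Θ) : γ θ ∈ S ↔ θ ∈ S := by rw [← mem_preimage, hSinv]
  have hbwd : ∀ θ ∈ S, γ.symm θ ∈ S := fun θ hθ => by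
    rwa [← hfwd, γ.apply_symm_apply]
  have hiter (n : ℕ) : (⇑γ)^[n] θ ∈ S := by
    induction n with
    | zero => exact hθ
    | succ n ih => rwa [Function.iterate_succ_apply', hfwd]
  have he (θ : Θ) : ‖vFull (αu θ)‖ = 1 := norm_vFull _
  have hinv : ∀ θ ∈ S, wedge (mulVecE (A θ) (vFull (αu θ))) (vFull (αu (γ θ))) = 0 :=
    fun θ hθ => (hS θ hθ).2.2.1
  have hrad : ∀ θ ∈ S, 0 < segmentRadius γ A h β (fun θ => vFull (αu θ)) θ := fun θ hθ => by
    obtain ⟨κ, hκ, hκn⟩ := exists_pos_le_radiusIter (e := fun θ => vFull (αu θ)) hh hβ hdet hC he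
      hbwd hinv hβ1 hθ (hS θ hθ).2.1
    exact hκ.trans_le (le_ciInf hκn)
  refine ⟨hrad θ hθ, attractorFib_eq_segment (e := fun θ => vFull (αu θ)) hh hβ hdet he hbwd hinv
    hβ2 hθ (hS θ hθ).2.1, fun v hv => ?_⟩
  refine tendsto_infDist_fibIter (e := fun θ => vFull (αu θ)) hh hβ hdet hC hscale he hpos
    (fun n => ?_) (fun n => hrad _ (hiter n)) (hS θ hθ).1 (hS θ hθ).2.2.2
    fun hw => hv (eq_smul_of_wedge_eq_zero (vFull_ne_zero _) hw)
  rw [Function.iterate_succ_apply']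
  exact hinv _ (hiter n)
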